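/- arXiv:2010.00650 — 3 statements merged into one kernel-verified Lean document; each statement's English description precedes it below -/
import Mathlib

section
/- Let F be a number field, n a nonzero integral ideal, m | n, and with notation as above, #Q_{m,n} = h^+ · h · #((R_m × R_{n/m})/U), where h^+ = #Cl^+(F) and h = #Cl(F). -/
open NumberField FractionalIdeal
open scoped nonZeroDivisors

noncomputable section

variable (F : Type*) [Field F] [NumberField F]

/-- Total positivity of an element of `F`. -/
def TotPos (x : F) : Prop := ∀ φ : F →+* ℝ, 0 < φ x

/-- The group of invertible fractional ideals of `F`. -/
abbrev Idl := (FractionalIdeal (𝓞 F)⁰ F)ˣ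

/-- The subgroup of fractional ideals "coprime to `c`": generated by the integral
ideals coprime to `c`. -/
def Jgrp (c : Ideal (𝓞 F)) : Subgroup (Idl F) :=
  Subgroup.closure {u | ∃ a : Ideal (𝓞 F), a + c = ⊤ ∧
    (u : FractionalIdeal (𝓞 F)⁰ F) = (a : FractionalIdeal (𝓞 F)⁰ F)}

/-- `Q_{m,n}` (with `n = m * n'`): the quotient of `G_m^+ × G_{n'}^+` by the subgroup
generated by diagonally embedded principal ideals `(x)` with `x ≡ 1 (mod n)`.
Here we realize `G_m^+ × G_{n'}^+` as the quotient of `J_m × J_{n'}` by the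
corresponding rays; equivalently, we quotient `J_m × J_{n'}` by the subgroup generated
by pairs of rays and diagonal principal ideals `(x)`, `x ≡ 1 mod n`.  Since a narrow
ray class in `G_m^+` is represented by elements of `J_m` modulo principal `(x)` with
`x` totally positive and `x ≡ 1 mod m`, we take the quotient of `J_m × J_{n'}` by the
subgroup generated by: pairs `((x), 1)` with `x` totally positive `≡ 1 mod m`, pairs
`(1, (y))` with `y` totally positive `≡ 1 mod n'`, and diagonal pairs `((x), (x))`
with `x ≡ 1 mod m*n'`. -/
def Dsub (m n' : Ideal (𝓞 F)) : Subgroup ((Jgrp F m) × (Jgrp F n')) :=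
  Subgroup.closure
    ({p | ∃ x : 𝓞 F, TotPos F (x : F) ∧ x - 1 ∈ m ∧
        ((p.1 : Idl F) : FractionalIdeal (𝓞 F)⁰ F) = spanSingleton (𝓞 F)⁰ (x : F) ∧
        p.2 = 1} ∪
     {p | ∃ y : 𝓞 F, TotPos F (y : F) ∧ y - 1 ∈ n' ∧ p.1 = 1 ∧
        ((p.2 : Idl F) : FractionalIdeal (𝓞 F)⁰ F) = spanSingleton (𝓞 F)⁰ (y : F)} ∪
     {p | ∃ x : 𝓞 F, x - 1 ∈ m * n' ∧
        ((p.1 : Idl F) : FractionalIdeal (𝓞 F)⁰ F) = spanSingleton (𝓞 F)⁰ (x : F) ∧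
        ((p.2 : Idl F) : FractionalIdeal (𝓞 F)⁰ F) = spanSingleton (𝓞 F)⁰ (x : F)})

/-- The group `Q_{m,n}` of the paper, `n = m * n'`. -/
def Qgrp (m n' : Ideal (𝓞 F)) :=
  ((Jgrp F m) × (Jgrp F n')) ⧸ Dsub F m n'

instance (m n' : Ideal (𝓞 F)) : Group (Qgrp F m n') :=
  inferInstanceAs (Group (((Jgrp F m) × (Jgrp F n')) ⧸ Dsub F m n'))

/-- The image of the totally positive units of `O_F` in `(O_F/c)ˣ`. -/
def posImage (c : Ideal (𝓞 F)) : Subgroup ((𝓞 F ⧸ c)ˣ) :=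
  Subgroup.closure {w | ∃ u : (𝓞 F)ˣ, TotPos F ((u : 𝓞 F) : F) ∧
    w = Units.map (Ideal.Quotient.mk c).toMonoidHom u}

/-- `R_c = (O_F/c)ˣ / O_{F,+}ˣ`. -/
def Rgrp (c : Ideal (𝓞 F)) := ((𝓞 F ⧸ c)ˣ) ⧸ posImage F c

instance (c : Ideal (𝓞 F)) : CommGroup (Rgrp F c) :=
  QuotientGroup.Quotient.commGroup (posImage F c)

/-- The diagonal image `U` of `O_Fˣ` in `R_m × R_{n'}`. -/
def Udiag (m n' : Ideal (𝓞 F)) : Subgroup (Rgrp F m × Rgrp F n') :=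
  Subgroup.closure {p | ∃ u : (𝓞 F)ˣ,
    p.1 = QuotientGroup.mk (Units.map (Ideal.Quotient.mk m).toMonoidHom u) ∧
    p.2 = QuotientGroup.mk (Units.map (Ideal.Quotient.mk n').toMonoidHom u)}

/-- `(R_m × R_{n'})/U`. -/
def RUgrp (m n' : Ideal (𝓞 F)) := (Rgrp F m × Rgrp F n') ⧸ Udiag F m n'

instance (m n' : Ideal (𝓞 F)) : Group (RUgrp F m n') :=
  inferInstanceAs (Group ((Rgrp F m × Rgrp F n') ⧸ Udiag F m n'))

/-- The subgroup of principal fractional ideals with totally positive generator. -/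
def PrinPos : Subgroup (Idl F) :=
  Subgroup.closure {u | ∃ x : F, TotPos F x ∧
    (u : FractionalIdeal (𝓞 F)⁰ F) = spanSingleton (𝓞 F)⁰ x}

/-- The narrow class group `Cl⁺(F)`. -/
def ClPlus := Idl F ⧸ PrinPos F

instance : Group (ClPlus F) := inferInstanceAs (Group (Idl F ⧸ PrinPos F))

variable {F}

set_option linter.unusedSectionVars false

namespace Stmt5

lemma TotPos.mul {a b : F} (ha : TotPos F a) (hb : TotPos F b) : TotPos F (a * b) := by
  intro φ
  rw [map_mul]
  exact mul_pos (ha φ) (hb φ)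

lemma TotPos.inv {a : F} (ha : TotPos F a) : TotPos F a⁻¹ := by
  intro φ
  rw [map_inv₀]
  exact inv_pos.2 (ha φ)

lemma TotPos.one : TotPos F (1 : F) := by
  intro φ
  simp

lemma TotPos.sq {a : F} (ha : a ≠ 0) : TotPos F (a * a) := by
  intro φ
  rw [map_mul]
  exact mul_self_pos.2 (by simpa using ha)

/-- Archimedean shifting. -/
lemma exists_shift (c : Ideal (𝓞 F)) (hc : c ≠ ⊥) (x w : 𝓞 F) (hw : w ≠ 0) :
    ∃ r ∈ c, x + r * w ≠ 0 ∧ TotPos F (((x + r * w : 𝓞 F) : F) * (w : F)) := by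
  set N : ℕ := Ideal.absNorm c with hN
  have hN0 : 0 < N := Nat.pos_of_ne_zero (by rw [hN]; exact Ideal.absNorm_eq_zero_iff.not.2 hc)
  have hNc : ((N : ℕ) : 𝓞 F) ∈ c := Ideal.absNorm_mem c
  have key : ∀ φ : F →+* ℝ, ∀ᶠ k : ℕ in Filter.atTop,
      0 < φ (((x + (N * k : ℕ) * w : 𝓞 F) : F) * (w : F)) := by
    intro φ
    have hpos : 0 < N * (φ w * φ w) := by
      have : φ (w : F) ≠ 0 := by simpa using hw
      have := mul_self_pos.2 this
      positivity
    obtain ⟨k0, hk0⟩ := exists_nat_gt (-(φ x * φ w) / (N * (φ w * φ w)))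
    filter_upwards [Filter.eventually_ge_atTop k0] with k hk
    have hk' : -(φ x * φ w) / (N * (φ w * φ w)) < k := lt_of_lt_of_le hk0 (by exact_mod_cast hk)
    rw [div_lt_iff₀ hpos] at hk'
    push_cast
    simp only [map_mul, map_add, map_natCast]
    nlinarith
  have key2 := Filter.eventually_all.2 key
  obtain ⟨k0, hk0⟩ := Filter.eventually_atTop.1 key2
  have hmem : ∀ k : ℕ, ((N * k : ℕ) : 𝓞 F) ∈ c := by
    intro k
    push_cast
    exact Ideal.mul_mem_right _ _ hNc
  by_cases h0 : x + ((N * k0 : ℕ) : 𝓞 F) * w = 0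
  · refine ⟨_, hmem (k0 + 1), ?_, hk0 _ (Nat.le_succ _)⟩
    have : x + ((N * (k0 + 1) : ℕ) : 𝓞 F) * w = N * w := by
      push_cast at h0 ⊢
      linear_combination h0
    rw [this]
    exact mul_ne_zero (by exact_mod_cast hN0.ne') hw
  · exact ⟨_, hmem k0, h0, hk0 _ le_rfl⟩

/-- principal ideals -/
abbrev pr : Fˣ →* Idl F := toPrincipalIdeal (𝓞 F) F

/-- nonzero integers as units of the field -/
def inU (x : 𝓞 F) (hx : x ≠ 0) : Fˣ := Units.mk0 (x : F) (by simpa using hx)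

@[simp] lemma inU_val (x : 𝓞 F) (hx : x ≠ 0) : ((inU x hx : Fˣ) : F) = x := rfl

lemma pr_inU (x : 𝓞 F) (hx : x ≠ 0) :
    ((pr (inU x hx) : Idl F) : FractionalIdeal (𝓞 F)⁰ F) = (Ideal.span {x} : Ideal (𝓞 F)) := by
  rw [coe_toPrincipalIdeal, coeIdeal_span_singleton, inU_val]

lemma pr_eq_iff (x y : Fˣ) : pr x = pr y ↔ ∃ u : (𝓞 F)ˣ, ((u : 𝓞 F) : F) * x = y := by
  rw [← Units.val_inj, coe_toPrincipalIdeal, coe_toPrincipalIdeal, spanSingleton_eq_spanSingleton]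
  apply exists_congr
  intro u
  rw [Units.smul_def, Algebra.smul_def]

/-- coprimality to an ideal -/
def Cop (c : Ideal (𝓞 F)) (x : 𝓞 F) : Prop := ∃ x', x * x' - 1 ∈ c

lemma Cop.of_one {c : Ideal (𝓞 F)} {x : 𝓞 F} (h : x - 1 ∈ c) : Cop c x := ⟨1, by simpa using h⟩

lemma cop_iff {c : Ideal (𝓞 F)} {x : 𝓞 F} : Cop c x ↔ Ideal.span {x} + c = ⊤ := by
  rw [Ideal.eq_top_iff_one]
  constructor
  · rintro ⟨x', h⟩
    have : (1 : 𝓞 F) = x * x' + -(x * x' - 1) := by ring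
    rw [this]
    exact Submodule.add_mem_sup (Ideal.mul_mem_right _ _ (Ideal.mem_span_singleton_self x))
      (neg_mem h)
  · intro h
    obtain ⟨a, ha, b, hb, hab⟩ := Submodule.mem_sup.1 h
    obtain ⟨x', rfl⟩ := Ideal.mem_span_singleton'.1 ha
    refine ⟨x', ?_⟩
    have : x * x' - 1 = - b := by rw [← hab]; ring
    rw [this]
    exact neg_mem hb

lemma cop_ideal_mul {I J c : Ideal (𝓞 F)} (hI : I + c = ⊤) (hJ : J + c = ⊤) : I * J + c = ⊤ := by
  have h1 : IsCoprime I c := Ideal.isCoprime_iff_add.2 (by rw [hI, Ideal.one_eq_top])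
  have h2 : IsCoprime J c := Ideal.isCoprime_iff_add.2 (by rw [hJ, Ideal.one_eq_top])
  rw [← Ideal.one_eq_top]
  exact Ideal.isCoprime_iff_add.1 (h1.mul_left h2)

lemma mem_J_of_cop {c : Ideal (𝓞 F)} {x : 𝓞 F} (hx : x ≠ 0) (h : Cop c x) :
    pr (inU x hx) ∈ Jgrp F c :=
  Subgroup.subset_closure ⟨_, cop_iff.1 h, pr_inU x hx⟩

lemma J_char {c : Ideal (𝓞 F)} {a : Idl F} (ha : a ∈ Jgrp F c) :
    ∃ I J : Ideal (𝓞 F), I + c = ⊤ ∧ J + c = ⊤ ∧ I ≠ ⊥ ∧ J ≠ ⊥ ∧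
      (a : FractionalIdeal (𝓞 F)⁰ F) * (J : FractionalIdeal (𝓞 F)⁰ F) = I := by
  induction ha using Subgroup.closure_induction with
  | mem u hu =>
    obtain ⟨I, hI, hu⟩ := hu
    refine ⟨I, ⊤, hI, by simp, ?_, by simp, ?_⟩
    · rintro rfl
      exact u.ne_zero (by rw [hu]; simp)
    · rw [hu]; simp
  | one => exact ⟨⊤, ⊤, by simp, by simp, by simp, by simp, by simp⟩
  | mul a b _ _ k1 k2 =>
    obtain ⟨I, J, h1, h2, h3, h4, h5⟩ := k1
    obtain ⟨I', J', h1', h2', h3', h4', h5'⟩ := k2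
    refine ⟨I * I', J * J', cop_ideal_mul h1 h1', cop_ideal_mul h2 h2', mul_ne_zero h3 h3',
      mul_ne_zero h4 h4', ?_⟩
    rw [coeIdeal_mul, coeIdeal_mul, ← h5, ← h5', Units.val_mul]
    ring
  | inv a _ h =>
    obtain ⟨I, J, h1, h2, h3, h4, h5⟩ := h
    refine ⟨J, I, h2, h1, h4, h3, ?_⟩
    rw [← h5, ← mul_assoc, Units.inv_mul, one_mul]

/-- Principal ideals in `J_c` have nice generators up to squares. -/
lemma J_principal {c : Ideal (𝓞 F)} {x : Fˣ} (hx : pr x ∈ Jgrp F c) :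
    ∃ (d y : 𝓞 F), d ≠ 0 ∧ y ≠ 0 ∧ d - 1 ∈ c ∧ Cop c y ∧ (d : F) * d * x = y := by
  obtain ⟨I, J, h1, h2, h3, h4, h5⟩ := J_char hx
  have : ∃ d ∈ J, d - 1 ∈ c ∧ d ≠ 0 := by
    have h := (Ideal.eq_top_iff_one _).1 h2
    obtain ⟨a, ha, b, hb, hab⟩ := Submodule.mem_sup.1 h
    by_cases h0 : a = 0
    · obtain ⟨j, hj, hj0⟩ := Submodule.exists_mem_ne_zero_of_ne_bot h4
      have hc : c = ⊤ := by
        rw [Ideal.eq_top_iff_one, ← hab, h0, zero_add]; exact hb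
      exact ⟨j, hj, by rw [hc]; trivial, hj0⟩
    · refine ⟨a, ha, ?_, h0⟩
      have : a - 1 = -b := by rw [← hab]; ring
      rw [this]; exact neg_mem hb
  obtain ⟨d, hdJ, hd1, hd0⟩ := this
  have hmem : (x : F) * d ∈ (I : FractionalIdeal (𝓞 F)⁰ F) := by
    rw [← h5]
    refine FractionalIdeal.mul_mem_mul ?_ ?_
    · rw [coe_toPrincipalIdeal]; exact mem_spanSingleton_self _ _
    · exact mem_coeIdeal_of_mem _ hdJ
  obtain ⟨z, hzI, hz⟩ := (mem_coeIdeal _).1 hmem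
  have hz' : (z : F) = x * d := hz
  have hz0 : z ≠ 0 := by
    rintro rfl
    have : (x : F) * d = 0 := by rw [← hz']; simp
    simp [hd0] at this
  have hid : Ideal.span {z} * J = Ideal.span {d} * I := by
    apply coeIdeal_injective (K := F)
    show ((Ideal.span {z} * J : Ideal (𝓞 F)) : FractionalIdeal (𝓞 F)⁰ F) =
      ((Ideal.span {d} * I : Ideal (𝓞 F)) : FractionalIdeal (𝓞 F)⁰ F)
    rw [coeIdeal_mul, coeIdeal_mul, ← h5, coeIdeal_span_singleton, coeIdeal_span_singleton,
      coe_toPrincipalIdeal, ← mul_assoc, spanSingleton_mul_spanSingleton]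
    congr 2
    rw [mul_comm]
    exact hz
  have hzc : Cop c z := by
    rw [cop_iff, eq_top_iff]
    have h6 : Ideal.span {d} * I + c = ⊤ := cop_ideal_mul (cop_iff.1 (Cop.of_one hd1)) h1
    rw [← h6, ← hid]
    exact sup_le_sup_right Ideal.mul_le_left _
  refine ⟨d, d * z, hd0, mul_ne_zero hd0 hz0, hd1, ?_, ?_⟩
  · obtain ⟨z', hz'⟩ := hzc
    refine ⟨z', ?_⟩
    have : d * z * z' - 1 = (d - 1) * (z * z') + (z * z' - 1) := by ring
    rw [this]
    exact add_mem (Ideal.mul_mem_right _ _ hd1) hz'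
  · have : ((d * z : 𝓞 F) : F) = d * z := rfl
    rw [this, hz']; ring

/-- moving lemma -/
lemma moving (c : Ideal (𝓞 F)) (hc : c ≠ ⊥) (a : Idl F) :
    ∃ b ∈ Jgrp F c, ∃ w : Fˣ, TotPos F (w : F) ∧ a = pr w * b := by
  obtain ⟨d, J, hd0, hJ⟩ := exists_eq_spanSingleton_mul ((a⁻¹ : Idl F) : FractionalIdeal (𝓞 F)⁰ F)
  have hJ0 : J ≠ ⊥ := by
    rintro rfl
    exact (a⁻¹).ne_zero (by rw [hJ]; simp)
  set I := Ideal.span {d} * J with hI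
  have hI0 : I ≠ ⊥ := mul_ne_zero (by simpa using hd0) hJ0
  obtain ⟨x, hx⟩ := IsDedekindDomain.exists_sup_span_eq (I := I * c) (J := I) Ideal.mul_le_left
    (mul_ne_zero hI0 hc)
  obtain ⟨r, hr, hr0, hrp⟩ := exists_shift (I * c) (mul_ne_zero hI0 hc) x 1 one_ne_zero
  rw [mul_one] at hr0 hrp
  set y := x + r with hy
  have hy' : I * c ⊔ Ideal.span {y} = I := by
    apply le_antisymm
    · refine sup_le Ideal.mul_le_left ?_
      rw [Ideal.span_singleton_le_iff_mem]
      refine add_mem ?_ (Ideal.mul_le_left hr)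
      rw [← hx]
      exact Ideal.mem_sup_right (Ideal.mem_span_singleton_self x)
    · conv_lhs => rw [← hx]
      refine sup_le le_sup_left ?_
      rw [Ideal.span_singleton_le_iff_mem]
      have : x = - r + y := by rw [hy]; ring
      rw [this]
      exact Submodule.add_mem_sup (neg_mem hr) (Ideal.mem_span_singleton_self y)
  have hyI : Ideal.span {y} ≤ I := by rw [← hy']; exact le_sup_right
  obtain ⟨A, hA⟩ := Ideal.dvd_iff_le.2 hyI
  have hAc : A + c = ⊤ := by
    have : I * (A + c) = I * ⊤ := by
      rw [mul_add, ← hA, Ideal.mul_top]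
      conv_rhs => rw [← hy']
      exact sup_comm _ _
    exact mul_left_cancel₀ hI0 this
  have hdd : d * d ≠ 0 := mul_ne_zero hd0 hd0
  refine ⟨pr ((inU y hr0) * (inU (d * d) hdd)⁻¹) * a, Subgroup.subset_closure ⟨A, hAc, ?_⟩,
    (inU (d * d) hdd) * (inU y hr0)⁻¹, ?_, ?_⟩
  · have hJ2 : ((a⁻¹ : Idl F) : FractionalIdeal (𝓞 F)⁰ F) * ((pr (inU (d * d) hdd) : Idl F) :
        FractionalIdeal (𝓞 F)⁰ F) = I := by
      rw [pr_inU, hJ, hI, coeIdeal_mul, coeIdeal_span_singleton, coeIdeal_span_singleton,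
        mul_right_comm, spanSingleton_mul_spanSingleton]
      congr 2
      have : algebraMap (𝓞 F) F d ≠ 0 := by simpa using hd0
      rw [map_mul]
      field_simp
    have hA2 : ((pr (inU y hr0) : Idl F) : FractionalIdeal (𝓞 F)⁰ F) =
        ((a⁻¹ * pr (inU (d * d) hdd) : Idl F) : FractionalIdeal (𝓞 F)⁰ F) * A := by
      rw [Units.val_mul, hJ2, pr_inU, hA, coeIdeal_mul]
    have : pr (inU y hr0 * (inU (d * d) hdd)⁻¹) * a =
        (a⁻¹ * pr (inU (d * d) hdd))⁻¹ * pr (inU y hr0) := by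
      rw [map_mul, map_inv, mul_inv, inv_inv]
      ac_rfl
    rw [this, Units.val_mul, hA2, ← mul_assoc, Units.inv_mul, one_mul]
  · have h1 : TotPos F (y : F) := by simpa using hrp
    have h2 : TotPos F ((d : F) * d) := TotPos.sq (by simpa using hd0)
    rw [Units.val_mul, Units.val_inv_eq_inv_val]
    exact TotPos.mul (by simpa using h2) (TotPos.inv h1)
  · simp only [map_mul, map_inv]
    group

/-- multiplicative congruence to one -/
def One (c : Ideal (𝓞 F)) (ξ : Fˣ) : Prop :=
  ∃ s t : 𝓞 F, s ≠ 0 ∧ t ≠ 0 ∧ s - 1 ∈ c ∧ t - 1 ∈ c ∧ (ξ : F) * t = s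

lemma sub_one_mul {c : Ideal (𝓞 F)} {s t : 𝓞 F} (hs : s - 1 ∈ c) (ht : t - 1 ∈ c) :
    s * t - 1 ∈ c := by
  have : s * t - 1 = (s - 1) * t + (t - 1) := by ring
  rw [this]
  exact add_mem (Ideal.mul_mem_right _ _ hs) ht

lemma coe_mul' (a b : 𝓞 F) : ((a * b : 𝓞 F) : F) = a * b := rfl

lemma coe_ne {a : 𝓞 F} (h : a ≠ 0) : (a : F) ≠ 0 := by simpa using h

lemma One.one (c : Ideal (𝓞 F)) : One c 1 := ⟨1, 1, one_ne_zero, one_ne_zero, by simp, by simp, by simp⟩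

lemma One.mul {c : Ideal (𝓞 F)} {a b : Fˣ} (ha : One c a) (hb : One c b) : One c (a * b) := by
  obtain ⟨s, t, h1, h2, h3, h4, h5⟩ := ha
  obtain ⟨s', t', h1', h2', h3', h4', h5'⟩ := hb
  refine ⟨s * s', t * t', mul_ne_zero h1 h1', mul_ne_zero h2 h2', sub_one_mul h3 h3',
    sub_one_mul h4 h4', ?_⟩
  rw [coe_mul', coe_mul', ← h5, ← h5', Units.val_mul]
  ring

lemma One.inv {c : Ideal (𝓞 F)} {a : Fˣ} (ha : One c a) : One c a⁻¹ := by
  obtain ⟨s, t, h1, h2, h3, h4, h5⟩ := ha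
  refine ⟨t, s, h2, h1, h4, h3, ?_⟩
  rw [← h5, ← mul_assoc, Units.inv_mul, one_mul]

lemma One.inU {c : Ideal (𝓞 F)} {x : 𝓞 F} (hx : x ≠ 0) (h : x - 1 ∈ c) : One c (inU x hx) :=
  ⟨x, 1, hx, one_ne_zero, h, by simp, by simp⟩

lemma One.eq_div {c : Ideal (𝓞 F)} {ξ : Fˣ} (h : One c ξ) (hp : TotPos F (ξ : F)) :
    ∃ (s t : 𝓞 F) (hs : s ≠ 0) (ht : t ≠ 0), s - 1 ∈ c ∧ t - 1 ∈ c ∧ TotPos F (s : F) ∧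
      TotPos F (t : F) ∧ ξ = Stmt5.inU s hs * (Stmt5.inU t ht)⁻¹ := by
  obtain ⟨s, t, h1, h2, h3, h4, h5⟩ := h
  have htt : TotPos F ((t * t : 𝓞 F) : F) := TotPos.sq (coe_ne h2)
  refine ⟨s * t, t * t, mul_ne_zero h1 h2, mul_ne_zero h2 h2, sub_one_mul h3 h4, sub_one_mul h4 h4,
    ?_, htt, ?_⟩
  · have : ((s * t : 𝓞 F) : F) = ξ * (t * t : 𝓞 F) := by
      rw [coe_mul', coe_mul', ← h5]; ring
    rw [this]
    exact TotPos.mul hp htt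
  · rw [eq_mul_inv_iff_mul_eq]
    ext
    simp only [Units.val_mul, inU_val, coe_mul', ← h5]
    ring

lemma One.mem_J {c : Ideal (𝓞 F)} {ξ : Fˣ} (h : One c ξ) : pr ξ ∈ Jgrp F c := by
  obtain ⟨s, t, h1, h2, h3, h4, h5⟩ := h
  have : ξ = Stmt5.inU s h1 * (Stmt5.inU t h2)⁻¹ := by
    rw [eq_mul_inv_iff_mul_eq]
    ext
    simpa using h5
  rw [this, map_mul, map_inv]
  exact mul_mem (mem_J_of_cop _ (Cop.of_one h3)) (inv_mem (mem_J_of_cop _ (Cop.of_one h4)))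

lemma mem_D_left {m n' : Ideal (𝓞 F)} {ξ : Fˣ} (h : One m ξ) (hp : TotPos F (ξ : F)) :
    ((⟨pr ξ, h.mem_J⟩, 1) : Jgrp F m × Jgrp F n') ∈ Dsub F m n' := by
  obtain ⟨s, t, hs, ht, hs1, ht1, hsp, htp, rfl⟩ := h.eq_div hp
  have key : ∀ (x : 𝓞 F) (hx : x ≠ 0) (hx1 : x - 1 ∈ m), TotPos F (x : F) →
      ((⟨pr (inU x hx), (One.inU hx hx1).mem_J⟩, 1) : Jgrp F m × Jgrp F n') ∈ Dsub F m n' := by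
    intro x hx hx1 hxp
    exact Subgroup.subset_closure (Or.inl (Or.inl ⟨x, hxp, hx1, by simp [coe_toPrincipalIdeal], rfl⟩))
  have := mul_mem (key s hs hs1 hsp) (inv_mem (key t ht ht1 htp))
  convert this using 1
  ext <;> simp

lemma mem_D_right {m n' : Ideal (𝓞 F)} {ξ : Fˣ} (h : One n' ξ) (hp : TotPos F (ξ : F)) :
    ((1, ⟨pr ξ, h.mem_J⟩) : Jgrp F m × Jgrp F n') ∈ Dsub F m n' := by
  obtain ⟨s, t, hs, ht, hs1, ht1, hsp, htp, rfl⟩ := h.eq_div hp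
  have key : ∀ (x : 𝓞 F) (hx : x ≠ 0) (hx1 : x - 1 ∈ n'), TotPos F (x : F) →
      ((1, ⟨pr (inU x hx), (One.inU hx hx1).mem_J⟩) : Jgrp F m × Jgrp F n') ∈ Dsub F m n' := by
    intro x hx hx1 hxp
    exact Subgroup.subset_closure (Or.inl (Or.inr ⟨x, hxp, hx1, rfl, by simp [coe_toPrincipalIdeal]⟩))
  have := mul_mem (key s hs hs1 hsp) (inv_mem (key t ht ht1 htp))
  convert this using 1
  ext <;> simp

lemma eq_pr_of_span {u : Idl F} {x : F}
    (h : (u : FractionalIdeal (𝓞 F)⁰ F) = spanSingleton (𝓞 F)⁰ x) :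
    ∃ hx : x ≠ 0, u = pr (Units.mk0 x hx) := by
  have hx : x ≠ 0 := by
    rintro rfl
    exact u.ne_zero (by rw [h]; simp)
  refine ⟨hx, ?_⟩
  ext1
  rw [h, coe_toPrincipalIdeal, Units.val_mk0]

lemma eq_pr_of_span' {u : Idl F} {x : 𝓞 F}
    (h : (u : FractionalIdeal (𝓞 F)⁰ F) = spanSingleton (𝓞 F)⁰ (x : F)) :
    ∃ hx : x ≠ 0, u = pr (inU x hx) := by
  obtain ⟨hx, h⟩ := eq_pr_of_span h
  exact ⟨by simpa using hx, h⟩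

set_option maxHeartbeats 1600000 in
lemma mem_D_iff {m n' : Ideal (𝓞 F)} (hm : m ≠ ⊥) (hn' : n' ≠ ⊥) (p : Jgrp F m × Jgrp F n') :
    p ∈ Dsub F m n' ↔ ∃ ξ η : Fˣ, One m ξ ∧ One n' η ∧ TotPos F ((ξ : F) * η) ∧
      (p.1 : Idl F) = pr ξ ∧ (p.2 : Idl F) = pr η := by
  constructor
  · intro hp
    induction hp using Subgroup.closure_induction with
    | mem p hp =>
      rcases hp with (⟨x, hx, hx1, h1, h2⟩ | ⟨x, hx, hx1, h1, h2⟩) | ⟨x, hx1, h1, h2⟩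
      · obtain ⟨hx0, h1⟩ := eq_pr_of_span' h1
        exact ⟨inU x hx0, 1, One.inU _ hx1, One.one _, by simpa using hx, h1, by simp [h2]⟩
      · obtain ⟨hx0, h2⟩ := eq_pr_of_span' h2
        exact ⟨1, inU x hx0, One.one _, One.inU _ hx1, by simpa using hx, by simp [h1], h2⟩
      · obtain ⟨hx0, h1⟩ := eq_pr_of_span' h1
        obtain ⟨_, h2⟩ := eq_pr_of_span' h2
        exact ⟨inU x hx0, inU x hx0, One.inU hx0 (Ideal.mul_le_left (I := m) (J := n') hx1),
          One.inU hx0 (Ideal.mul_le_right (I := m) (J := n') hx1),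
          TotPos.sq (coe_ne hx0), h1, h2⟩
    | one => exact ⟨1, 1, One.one _, One.one _, by simpa using TotPos.one, by simp, by simp⟩
    | mul a b _ _ k1 k2 =>
      obtain ⟨x, y, h1, h2, h3, h4, h5⟩ := k1
      obtain ⟨x', y', h1', h2', h3', h4', h5'⟩ := k2
      refine ⟨x * x', y * y', h1.mul h1', h2.mul h2', ?_, by simp [h4, h4'], by simp [h5, h5']⟩
      have := TotPos.mul h3 h3'
      rw [Units.val_mul, Units.val_mul]
      convert this using 1
      ring
    | inv a _ k =>
      obtain ⟨x, y, h1, h2, h3, h4, h5⟩ := k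
      refine ⟨x⁻¹, y⁻¹, h1.inv, h2.inv, ?_, by simp [h4], by simp [h5]⟩
      have := TotPos.inv h3
      convert this using 1
      simp [mul_comm]
  · rintro ⟨ξ, η, h1, h2, h3, h4, h5⟩
    obtain ⟨s, t, hs, ht, hs1, ht1, hst⟩ := id h1
    obtain ⟨r, hr, hz0, hzp⟩ := exists_shift (m * n') (mul_ne_zero hm hn') 1 (s * t)
      (mul_ne_zero hs ht)
    set z := 1 + r * (s * t) with hz
    have hz1 : z - 1 ∈ m * n' := by
      rw [hz, add_sub_cancel_left]
      exact Ideal.mul_mem_right _ _ hr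
    have hzm := One.inU hz0 (Ideal.mul_le_left (I := m) (J := n') hz1)
    have hzn := One.inU hz0 (Ideal.mul_le_right (I := m) (J := n') hz1)
    have hz0' : (z : F) ≠ 0 := coe_ne hz0
    have ht0' : (t : F) ≠ 0 := coe_ne ht
    have hp1 : TotPos F ((ξ * (inU z hz0)⁻¹ : Fˣ) : F) := by
      have := TotPos.mul hzp (TotPos.inv (TotPos.mul (TotPos.sq hz0') (TotPos.sq ht0')))
      convert this using 1
      rw [Units.val_mul, Units.val_inv_eq_inv_val, inU_val, coe_mul', ← hst]
      field_simp
    have hp2 : TotPos F ((η * (inU z hz0)⁻¹ : Fˣ) : F) := by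
      have := TotPos.mul (TotPos.mul h3 (TotPos.inv hp1)) (TotPos.inv (TotPos.sq hz0'))
      convert this using 1
      rw [Units.val_mul, Units.val_mul, Units.val_inv_eq_inv_val, inU_val]
      have := ξ.ne_zero
      field_simp
    have e1 := mem_D_left (n' := n') (h1.mul hzm.inv) hp1
    have e2 := mem_D_right (m := m) (h2.mul hzn.inv) hp2
    have e3 : ((⟨pr (inU z hz0), hzm.mem_J⟩, ⟨pr (inU z hz0), hzn.mem_J⟩) : Jgrp F m × Jgrp F n') ∈
        Dsub F m n' :=
      Subgroup.subset_closure (Or.inr ⟨z, hz1, by simp [coe_toPrincipalIdeal],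
        by simp [coe_toPrincipalIdeal]⟩)
    have := mul_mem (mul_mem e1 e2) e3
    convert this using 1
    ext1
    · ext1; simp [h4]
    · ext1; simp [h5]

lemma mem_PrinPos_iff (a : Idl F) : a ∈ PrinPos F ↔ ∃ w : Fˣ, TotPos F (w : F) ∧ a = pr w := by
  constructor
  · intro h
    induction h using Subgroup.closure_induction with
    | mem p hp =>
      obtain ⟨x, hx, h⟩ := hp
      obtain ⟨hx0, h⟩ := eq_pr_of_span h
      exact ⟨_, hx, h⟩
    | one => exact ⟨1, TotPos.one, by simp⟩
    | mul a b _ _ k1 k2 =>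
      obtain ⟨x, h1, rfl⟩ := k1
      obtain ⟨y, h2, rfl⟩ := k2
      exact ⟨x * y, TotPos.mul h1 h2, by simp⟩
    | inv a _ k =>
      obtain ⟨x, h1, rfl⟩ := k
      exact ⟨x⁻¹, by simpa using TotPos.inv h1, by simp⟩
  · rintro ⟨w, hw, rfl⟩
    exact Subgroup.subset_closure ⟨w, hw, coe_toPrincipalIdeal _⟩

lemma classGroup_mk_eq_one_iff (a : Idl F) : ClassGroup.mk F a = 1 ↔ ∃ w : Fˣ, a = pr w := by
  rw [ClassGroup.mk_eq_one_iff]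
  constructor
  · intro h
    obtain ⟨x, hx⟩ := h.principal
    have : (a : FractionalIdeal (𝓞 F)⁰ F) = spanSingleton (𝓞 F)⁰ x := by
      apply coeToSubmodule_injective
      simpa using hx
    obtain ⟨h0, h⟩ := eq_pr_of_span this
    exact ⟨_, h⟩
  · rintro ⟨w, rfl⟩
    exact ⟨(w : F), by simp [coe_toPrincipalIdeal]⟩

/-- the class map -/
def Phi (m n' : Ideal (𝓞 F)) : Jgrp F m × Jgrp F n' →* (Idl F ⧸ PrinPos F) × ClassGroup (𝓞 F) :=
  MonoidHom.prod
    ((QuotientGroup.mk' (PrinPos F)).comp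
      (MonoidHom.coprod (Jgrp F m).subtype (Jgrp F n').subtype))
    ((ClassGroup.mk F).comp ((Jgrp F n').subtype.comp (MonoidHom.snd _ _)))

lemma mem_ker_Phi {m n' : Ideal (𝓞 F)} (p : Jgrp F m × Jgrp F n') :
    p ∈ (Phi m n').ker ↔ ∃ x y : Fˣ, TotPos F ((x : F) * y) ∧
      (p.1 : Idl F) = pr x ∧ (p.2 : Idl F) = pr y := by
  have : p ∈ (Phi m n').ker ↔ ((p.1 : Idl F) * p.2 ∈ PrinPos F ∧ ClassGroup.mk F (p.2 : Idl F) = 1) := by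
    rw [MonoidHom.mem_ker, Prod.ext_iff, ← QuotientGroup.eq_one_iff]
    rfl
  rw [this, mem_PrinPos_iff, classGroup_mk_eq_one_iff]
  constructor
  · rintro ⟨⟨w, hw, h1⟩, y, h2⟩
    refine ⟨w * y⁻¹, y, by simpa using hw, ?_, h2⟩
    rw [map_mul, map_inv, ← h1, ← h2]
    simp
  · rintro ⟨x, y, h, h1, h2⟩
    exact ⟨⟨x * y, by simpa using h, by rw [h1, h2, map_mul]⟩, y, h2⟩

lemma Phi_surj {m n' : Ideal (𝓞 F)} (hm : m ≠ ⊥) (hn' : n' ≠ ⊥) :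
    Function.Surjective (Phi m n') := by
  rintro ⟨A, B⟩
  obtain ⟨B, rfl⟩ : ∃ B' : Idl F, ClassGroup.mk F B' = B :=
    ClassGroup.induction (K := F) (P := fun B => ∃ B' : Idl F, ClassGroup.mk F B' = B)
      (fun I => ⟨I, rfl⟩) B
  obtain ⟨A, rfl⟩ := QuotientGroup.mk_surjective A
  obtain ⟨b, hb, w, hw, rfl⟩ := moving n' hn' B
  obtain ⟨a, ha, v, hv, h⟩ := moving m hm (A * b⁻¹)
  refine ⟨(⟨a, ha⟩, ⟨b, hb⟩), Prod.ext ?_ ?_⟩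
  · show (QuotientGroup.mk (a * b) : Idl F ⧸ PrinPos F) = QuotientGroup.mk A
    rw [QuotientGroup.eq, mem_PrinPos_iff]
    refine ⟨v, hv, ?_⟩
    have h' : A = pr v * a * b := by rw [← h]; group
    rw [h', mul_assoc (pr v) a b, mul_left_comm, inv_mul_cancel, mul_one]
  · show ClassGroup.mk F b = ClassGroup.mk F (pr w * b)
    rw [map_mul, (classGroup_mk_eq_one_iff _).2 ⟨w, rfl⟩, one_mul]

lemma mem_posImage_iff {c : Ideal (𝓞 F)} (w : (𝓞 F ⧸ c)ˣ) :
    w ∈ posImage F c ↔ ∃ u : (𝓞 F)ˣ, TotPos F ((u : 𝓞 F) : F) ∧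
      w = Units.map (Ideal.Quotient.mk c).toMonoidHom u := by
  constructor
  · intro h
    induction h using Subgroup.closure_induction with
    | mem p hp => exact hp
    | one => exact ⟨1, by simpa using TotPos.one, by simp⟩
    | mul a b _ _ k1 k2 =>
      obtain ⟨x, h1, rfl⟩ := k1
      obtain ⟨y, h2, rfl⟩ := k2
      exact ⟨x * y, TotPos.mul h1 h2, by simp⟩
    | inv a _ k =>
      obtain ⟨x, h1, rfl⟩ := k
      refine ⟨x⁻¹, ?_, by rw [map_inv]⟩
      have h : (((x⁻¹ : (𝓞 F)ˣ) : 𝓞 F) : F) = ((x : 𝓞 F) : F)⁻¹ := by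
        apply eq_inv_of_mul_eq_one_left
        rw [← coe_mul', Units.inv_mul]
        rfl
      rw [h]
      exact TotPos.inv h1
  · intro h
    exact Subgroup.subset_closure h

/-- units mod c -/
abbrev um (c : Ideal (𝓞 F)) : (𝓞 F)ˣ →* (𝓞 F ⧸ c)ˣ :=
  Units.map (Ideal.Quotient.mk c).toMonoidHom

/-- class in R -/
def rmk (c : Ideal (𝓞 F)) : (𝓞 F ⧸ c)ˣ →* Rgrp F c := QuotientGroup.mk' (posImage F c)

lemma rmk_eq_one {c : Ideal (𝓞 F)} (a : (𝓞 F ⧸ c)ˣ) : rmk c a = 1 ↔ a ∈ posImage F c :=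
  QuotientGroup.eq_one_iff a

lemma rmk_surj (c : Ideal (𝓞 F)) : Function.Surjective (rmk c) := QuotientGroup.mk_surjective

lemma mem_Udiag_iff {m n' : Ideal (𝓞 F)} (p : Rgrp F m × Rgrp F n') :
    p ∈ Udiag F m n' ↔ ∃ u : (𝓞 F)ˣ, p.1 = rmk m (um m u) ∧ p.2 = rmk n' (um n' u) := by
  constructor
  · intro h
    induction h using Subgroup.closure_induction with
    | mem p hp => exact hp
    | one => exact ⟨1, by simp, by simp⟩
    | mul a b _ _ k1 k2 =>
      obtain ⟨x, h1, h2⟩ := k1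
      obtain ⟨y, h3, h4⟩ := k2
      exact ⟨x * y, by rw [Prod.fst_mul, h1, h3, map_mul, map_mul],
        by rw [Prod.snd_mul, h2, h4, map_mul, map_mul]⟩
    | inv a _ k =>
      obtain ⟨x, h1, h2⟩ := k
      exact ⟨x⁻¹, by rw [Prod.fst_inv, h1, map_inv, map_inv],
        by rw [Prod.snd_inv, h2, map_inv, map_inv]⟩
  · intro h
    exact Subgroup.subset_closure h

/-- class in RU -/
def rumk (m n' : Ideal (𝓞 F)) (a : (𝓞 F ⧸ m)ˣ) (b : (𝓞 F ⧸ n')ˣ) : RUgrp F m n' :=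
  (QuotientGroup.mk (rmk m a, rmk n' b) : (Rgrp F m × Rgrp F n') ⧸ Udiag F m n')

lemma rumk_surj {m n' : Ideal (𝓞 F)} (r : RUgrp F m n') : ∃ a b, rumk m n' a b = r := by
  obtain ⟨⟨a, b⟩, rfl⟩ := QuotientGroup.mk_surjective (s := Udiag F m n') r
  obtain ⟨a, rfl⟩ := rmk_surj m a
  obtain ⟨b, rfl⟩ := rmk_surj n' b
  exact ⟨a, b, rfl⟩

lemma rmk_eq_iff {c : Ideal (𝓞 F)} (a b : (𝓞 F ⧸ c)ˣ) (u : (𝓞 F)ˣ) :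
    (rmk c a)⁻¹ * rmk c b = rmk c (um c u) ↔
      ∃ e : (𝓞 F)ˣ, TotPos F ((e : 𝓞 F) : F) ∧ b = a * um c u * um c e := by
  have : (rmk c a)⁻¹ * rmk c b = rmk c (um c u) ↔ rmk c ((a * um c u)⁻¹ * b) = 1 := by
    rw [map_mul, map_inv, map_mul, inv_mul_eq_one, inv_mul_eq_iff_eq_mul, eq_comm]
  rw [this, rmk_eq_one, mem_posImage_iff]
  simp only [inv_mul_eq_iff_eq_mul]

lemma rumk_eq_iff {m n' : Ideal (𝓞 F)} (a a' : (𝓞 F ⧸ m)ˣ) (b b' : (𝓞 F ⧸ n')ˣ) :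
    rumk m n' a b = rumk m n' a' b' ↔ ∃ u e1 e2 : (𝓞 F)ˣ, TotPos F ((e1 : 𝓞 F) : F) ∧
      TotPos F ((e2 : 𝓞 F) : F) ∧ a' = a * um m u * um m e1 ∧ b' = b * um n' u * um n' e2 := by
  have : rumk m n' a b = rumk m n' a' b' ↔
      ((rmk m a, rmk n' b)⁻¹ * (rmk m a', rmk n' b') : Rgrp F m × Rgrp F n') ∈ Udiag F m n' :=
    QuotientGroup.eq
  rw [this, mem_Udiag_iff]
  apply exists_congr
  intro u
  have h1 := rmk_eq_iff a a' u
  have h2 := rmk_eq_iff b b' u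
  constructor
  · rintro ⟨k1, k2⟩
    obtain ⟨e1, he1, h1⟩ := h1.1 k1
    obtain ⟨e2, he2, h2⟩ := h2.1 k2
    exact ⟨e1, e2, he1, he2, h1, h2⟩
  · rintro ⟨e1, e2, he1, he2, k1, k2⟩
    exact ⟨h1.2 ⟨e1, he1, k1⟩, h2.2 ⟨e2, he2, k2⟩⟩

lemma Cop.isUnit {c : Ideal (𝓞 F)} {x : 𝓞 F} (h : Cop c x) : IsUnit (Ideal.Quotient.mk c x) := by
  obtain ⟨x', h⟩ := h
  refine IsUnit.of_mul_eq_one (Ideal.Quotient.mk c x') ?_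
  rw [← map_mul, ← map_one (Ideal.Quotient.mk c)]
  exact Ideal.Quotient.eq.2 h

/-- every residue class has a totally positive representative -/
lemma exists_rep (c : Ideal (𝓞 F)) (hc : c ≠ ⊥) (a : (𝓞 F ⧸ c)ˣ) :
    ∃ x : 𝓞 F, x ≠ 0 ∧ TotPos F (x : F) ∧ Cop c x ∧ Ideal.Quotient.mk c x = a := by
  obtain ⟨y, hy⟩ := Ideal.Quotient.mk_surjective (a : 𝓞 F ⧸ c)
  obtain ⟨z, hz⟩ := Ideal.Quotient.mk_surjective ((a⁻¹ : (𝓞 F ⧸ c)ˣ) : 𝓞 F ⧸ c)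
  obtain ⟨r, hr, h0, hp⟩ := exists_shift c hc y 1 one_ne_zero
  rw [mul_one] at h0 hp
  have hx : Ideal.Quotient.mk c (y + r) = a := by
    rw [map_add, Ideal.Quotient.eq_zero_iff_mem.2 hr, add_zero, hy]
  refine ⟨y + r, h0, by simpa using hp, ⟨z, ?_⟩, hx⟩
  rw [← Ideal.Quotient.eq, map_mul, hx, hz, map_one, Units.mul_inv]

/-- integral pairs with equal signs -/
structure Mset (m n' : Ideal (𝓞 F)) where
  x : 𝓞 F
  y : 𝓞 F
  hx : x ≠ 0
  hy : y ≠ 0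
  cx : Cop m x
  cy : Cop n' y
  pos : TotPos F ((x : F) * y)

variable {m n' : Ideal (𝓞 F)}

/-- the pair of ideals of a pair -/
def Mset.j (a : Mset m n') : Jgrp F m × Jgrp F n' :=
  (⟨pr (inU a.x a.hx), mem_J_of_cop _ a.cx⟩, ⟨pr (inU a.y a.hy), mem_J_of_cop _ a.cy⟩)

lemma Mset.j_mem (a : Mset m n') : a.j ∈ (Phi m n').ker :=
  (mem_ker_Phi _).2 ⟨inU a.x a.hx, inU a.y a.hy, a.pos, rfl, rfl⟩

/-- the class mod D -/
def Mset.f (a : Mset m n') : (Phi m n').ker ⧸ (Dsub F m n').subgroupOf (Phi m n').ker :=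
  QuotientGroup.mk ⟨a.j, a.j_mem⟩

/-- the class in RU -/
def Mset.g (a : Mset m n') : RUgrp F m n' := rumk m n' a.cx.isUnit.unit a.cy.isUnit.unit

lemma Mset.g_surj (hm : m ≠ ⊥) (hn' : n' ≠ ⊥) : Function.Surjective (Mset.g (m := m) (n' := n')) := by
  intro r
  obtain ⟨a, b, rfl⟩ := rumk_surj r
  obtain ⟨x, hx, px, cx, ex⟩ := exists_rep m hm a
  obtain ⟨y, hy, py, cy, ey⟩ := exists_rep n' hn' b
  refine ⟨⟨x, y, hx, hy, cx, cy, TotPos.mul px py⟩, ?_⟩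
  have h1 : cx.isUnit.unit = a := by ext; exact ex
  have h2 : cy.isUnit.unit = b := by ext; exact ey
  show rumk m n' cx.isUnit.unit cy.isUnit.unit = _
  rw [h1, h2]

lemma Mset.f_surj (hm : m ≠ ⊥) (hn' : n' ≠ ⊥) : Function.Surjective (Mset.f (m := m) (n' := n')) := by
  intro q
  obtain ⟨⟨p, hp⟩, rfl⟩ := QuotientGroup.mk_surjective q
  obtain ⟨x, y, hxy, h1, h2⟩ := (mem_ker_Phi p).1 hp
  obtain ⟨d, x1, hd, hx1, hd1, cx, ex⟩ := J_principal (c := m) (x := x) (h1 ▸ p.1.2)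
  obtain ⟨d', y1, hd', hy1, hd1', cy, ey⟩ := J_principal (c := n') (x := y) (h2 ▸ p.2.2)
  have pos : TotPos F ((x1 : F) * y1) := by
    rw [← ex, ← ey]
    have := TotPos.mul (TotPos.mul (TotPos.sq (coe_ne hd)) (TotPos.sq (coe_ne hd'))) hxy
    convert this using 1
    ring
  refine ⟨⟨x1, y1, hx1, hy1, cx, cy, pos⟩, ?_⟩
  refine QuotientGroup.eq.2 ?_
  rw [Subgroup.mem_subgroupOf, mem_D_iff hm hn']
  have o1 : One m (inU (d * d) (mul_ne_zero hd hd)) := One.inU _ (sub_one_mul hd1 hd1)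
  have o2 : One n' (inU (d' * d') (mul_ne_zero hd' hd')) := One.inU _ (sub_one_mul hd1' hd1')
  refine ⟨(inU (d * d) (mul_ne_zero hd hd))⁻¹, (inU (d' * d') (mul_ne_zero hd' hd'))⁻¹, o1.inv, o2.inv,
    ?_, ?_, ?_⟩
  · rw [Units.val_inv_eq_inv_val, Units.val_inv_eq_inv_val]
    exact TotPos.mul (TotPos.inv (TotPos.sq (coe_ne hd))) (TotPos.inv (TotPos.sq (coe_ne hd')))
  · show (pr (inU x1 hx1))⁻¹ * (p.1 : Idl F) = _
    rw [h1, ← map_inv, ← map_mul]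
    congr 1
    rw [inv_mul_eq_iff_eq_mul, eq_mul_inv_iff_mul_eq]
    ext
    rw [Units.val_mul, inU_val, inU_val, coe_mul', ← ex]
    ring
  · show (pr (inU y1 hy1))⁻¹ * (p.2 : Idl F) = _
    rw [h2, ← map_inv, ← map_mul]
    congr 1
    rw [inv_mul_eq_iff_eq_mul, eq_mul_inv_iff_mul_eq]
    ext
    rw [Units.val_mul, inU_val, inU_val, coe_mul', ← ey]
    ring

lemma Mset.f_eq_iff (hm : m ≠ ⊥) (hn' : n' ≠ ⊥) (a b : Mset m n') :
    a.f = b.f ↔ ∃ ξ η : Fˣ, One m ξ ∧ One n' η ∧ TotPos F ((ξ : F) * η) ∧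
      pr ((inU a.x a.hx)⁻¹ * inU b.x b.hx) = pr ξ ∧ pr ((inU a.y a.hy)⁻¹ * inU b.y b.hy) = pr η := by
  have : a.f = b.f ↔ a.j⁻¹ * b.j ∈ Dsub F m n' := QuotientGroup.eq
  rw [this, mem_D_iff hm hn']
  simp only [map_mul, map_inv]
  rfl

/-- the residue relation from a global relation -/
lemma resid_of_one {c : Ideal (𝓞 F)} {x y : 𝓞 F} (hx : x ≠ 0) (hy : y ≠ 0) {ξ : Fˣ} (h : One c ξ)
    (he : pr ((inU x hx)⁻¹ * inU y hy) = pr ξ) :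
    ∃ u : (𝓞 F)ˣ, ((u : 𝓞 F) : F) * y = x * ξ ∧
      Ideal.Quotient.mk c x = Ideal.Quotient.mk c y * Ideal.Quotient.mk c u := by
  obtain ⟨u, hu⟩ := (pr_eq_iff _ _).1 he
  have hu' : ((u : 𝓞 F) : F) * y = x * ξ := by
    rw [← hu, Units.val_mul, Units.val_inv_eq_inv_val, inU_val, inU_val]
    have := coe_ne hx
    field_simp
  refine ⟨u, hu', ?_⟩
  obtain ⟨s, t, h1, h2, h3, h4, h5⟩ := h
  have key : (u : 𝓞 F) * y * t = x * s := by
    apply RingOfIntegers.ext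
    rw [coe_mul', coe_mul', coe_mul', hu', ← h5]
    ring
  have hs : Ideal.Quotient.mk c s = 1 := by
    rw [← map_one (Ideal.Quotient.mk c)]; exact Ideal.Quotient.eq.2 h3
  have ht : Ideal.Quotient.mk c t = 1 := by
    rw [← map_one (Ideal.Quotient.mk c)]; exact Ideal.Quotient.eq.2 h4
  have := congrArg (Ideal.Quotient.mk c) key
  rw [map_mul, map_mul, map_mul, hs, ht, mul_one, mul_one] at this
  rw [← this, mul_comm]

/-- conversely -/
lemma one_of_resid {c : Ideal (𝓞 F)} {x y : 𝓞 F} (hx : x ≠ 0) (hy : y ≠ 0) (hc : c ≠ ⊥)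
    (cx : Cop c x) (u : (𝓞 F)ˣ)
    (h : Ideal.Quotient.mk c y = Ideal.Quotient.mk c x * Ideal.Quotient.mk c u) :
    ∃ ξ : Fˣ, One c ξ ∧ pr ((inU x hx)⁻¹ * inU y hy) = pr ξ ∧ (ξ : F) * (x * (u : 𝓞 F)) = y := by
  have hu0 : (u : 𝓞 F) ≠ 0 := u.ne_zero
  obtain ⟨z, hz, pz, cz, ez⟩ := exists_rep c hc (cx.isUnit.unit * um c u)⁻¹
  have hxu : x * (u : 𝓞 F) ≠ 0 := mul_ne_zero hx hu0
  have e1 : Ideal.Quotient.mk c (x * (u : 𝓞 F) * z) = 1 := by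
    rw [map_mul, ez, map_mul]
    exact Units.mul_inv (cx.isUnit.unit * um c u)
  have e2 : Ideal.Quotient.mk c (y * z) = 1 := by
    rw [map_mul, h, ← map_mul, ← map_mul, e1]
  have hmem : ((inU y hy * (inU (x * (u : 𝓞 F)) hxu)⁻¹ : Fˣ) : F) * (x * (u : 𝓞 F)) = y := by
    rw [Units.val_mul, Units.val_inv_eq_inv_val, inU_val, inU_val, coe_mul']
    have := coe_ne hx
    have := coe_ne hu0
    field_simp
  refine ⟨inU y hy * (inU (x * (u : 𝓞 F)) hxu)⁻¹, ⟨y * z, x * (u : 𝓞 F) * z, mul_ne_zero hy hz, mul_ne_zero hxu hz,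
    Ideal.Quotient.eq.1 (by rw [e2, map_one]), Ideal.Quotient.eq.1 (by rw [e1, map_one]), ?_⟩, ?_, hmem⟩
  · rw [coe_mul', coe_mul', coe_mul', ← mul_assoc, hmem]
  · rw [eq_comm, pr_eq_iff]
    refine ⟨u, ?_⟩
    rw [Units.val_mul, Units.val_mul, Units.val_inv_eq_inv_val, Units.val_inv_eq_inv_val, inU_val,
      inU_val, inU_val, coe_mul']
    have := coe_ne hx
    have := coe_ne hu0
    field_simp

lemma unit_coe_inv (x : (𝓞 F)ˣ) : (((x⁻¹ : (𝓞 F)ˣ) : 𝓞 F) : F) = ((x : 𝓞 F) : F)⁻¹ := by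
  apply eq_inv_of_mul_eq_one_left
  rw [← coe_mul', Units.inv_mul]
  rfl

lemma TotPos.of_mul_right {a b : F} (h : TotPos F (a * b)) (hb : TotPos F b) : TotPos F a := by
  intro φ
  have := h φ
  rw [map_mul] at this
  exact pos_of_mul_pos_left this (hb φ).le

lemma Mset.f_iff_g (hm : m ≠ ⊥) (hn' : n' ≠ ⊥) (a b : Mset m n') : a.f = b.f ↔ a.g = b.g := by
  rw [Mset.f_eq_iff hm hn', Mset.g, Mset.g, rumk_eq_iff]
  constructor
  · rintro ⟨ξ, η, h1, h2, h3, h4, h5⟩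
    obtain ⟨u, hu, eu⟩ := resid_of_one a.hx b.hx h1 h4
    obtain ⟨v, hv, ev⟩ := resid_of_one a.hy b.hy h2 h5
    have pos : TotPos F (((u : 𝓞 F) : F) * (v : 𝓞 F)) := by
      apply TotPos.of_mul_right _ b.pos
      have := TotPos.mul a.pos h3
      convert this using 1
      linear_combination (v : 𝓞 F) * (b.y : F) * hu + (a.x : F) * ξ * hv
    refine ⟨v⁻¹, u⁻¹ * v, 1, ?_, by simpa using TotPos.one, ?_, ?_⟩
    · rw [Units.val_mul, coe_mul', unit_coe_inv]
      have h0 := coe_ne u.ne_zero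
      have := TotPos.mul pos (TotPos.inv (TotPos.sq h0))
      convert this using 1
      field_simp
    · rw [mul_assoc, ← map_mul, mul_left_comm, inv_mul_cancel, mul_one, map_inv,
        eq_mul_inv_iff_mul_eq]
      ext
      exact eu.symm
    · rw [map_one, mul_one, map_inv, eq_mul_inv_iff_mul_eq]
      ext
      exact ev.symm
  · rintro ⟨u, e1, e2, p1, p2, k1, k2⟩
    obtain ⟨ξ, o1, q1, r1⟩ := one_of_resid a.hx b.hx hm a.cx (u * e1) (by
      have := congrArg Units.val k1
      rw [mul_assoc, ← map_mul] at this
      exact this)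
    obtain ⟨η, o2, q2, r2⟩ := one_of_resid a.hy b.hy hn' a.cy (u * e2) (by
      have := congrArg Units.val k2
      rw [mul_assoc, ← map_mul] at this
      exact this)
    refine ⟨ξ, η, o1, o2, ?_, q1, q2⟩
    have hu0 := coe_ne u.ne_zero
    refine TotPos.of_mul_right (b := ((a.x : F) * a.y) * (((u : 𝓞 F) : F) * (u : 𝓞 F)) *
      (((e1 : 𝓞 F) : F) * (e2 : 𝓞 F))) ?_ ?_
    · have := b.pos
      rw [← r1, ← r2, Units.val_mul, Units.val_mul, coe_mul', coe_mul'] at this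
      convert this using 1
      ring
    · exact TotPos.mul (TotPos.mul a.pos (TotPos.sq hu0)) (TotPos.mul p1 p2)

lemma card_eq_of_surj {M A B : Type*} (f : M → A) (g : M → B) (hf : Function.Surjective f)
    (hg : Function.Surjective g) (h : ∀ a b, f a = f b ↔ g a = g b) : Nat.card A = Nat.card B := by
  apply Nat.card_congr
  refine Equiv.ofBijective (fun k => g (Function.surjInv hf k)) ⟨?_, ?_⟩
  · intro k k' hk
    have := (h _ _).2 hk
    rwa [Function.surjInv_eq hf, Function.surjInv_eq hf] at this
  · intro r
    obtain ⟨a, rfl⟩ := hg r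
    exact ⟨f a, (h _ _).1 (Function.surjInv_eq hf _)⟩

lemma card_ker_quot {G H : Type*} [Group G] [MulOneClass H] (f : G →* H)
    (hf : Function.Surjective f) : f.ker.index = Nat.card H := by
  refine card_eq_of_surj (QuotientGroup.mk : G → G ⧸ f.ker) f QuotientGroup.mk_surjective hf ?_
  intro a b
  rw [QuotientGroup.eq, MonoidHom.mem_ker]
  constructor
  · intro h
    have : f b = f a * f (a⁻¹ * b) := by rw [← map_mul, mul_inv_cancel_left]
    rw [this, h, mul_one]
  · intro h
    rw [map_mul, ← h, ← map_mul, inv_mul_cancel, map_one]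

lemma D_le (hm : m ≠ ⊥) (hn' : n' ≠ ⊥) : Dsub F m n' ≤ (Phi m n').ker := by
  intro p hp
  obtain ⟨ξ, η, -, -, h3, h4, h5⟩ := (mem_D_iff hm hn' p).1 hp
  exact (mem_ker_Phi p).2 ⟨ξ, η, h3, h4, h5⟩

theorem main (hm : m ≠ ⊥) (hn' : n' ≠ ⊥) :
    Nat.card (Qgrp F m n') =
      Nat.card (ClPlus F) * Nat.card (ClassGroup (𝓞 F)) * Nat.card (RUgrp F m n') := by
  have h1 : Nat.card (Qgrp F m n') = (Dsub F m n').index := rfl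
  have h2 : (Phi m n').ker.index = Nat.card (ClPlus F) * Nat.card (ClassGroup (𝓞 F)) := by
    exact (card_ker_quot _ (Phi_surj hm hn')).trans (Nat.card_prod _ _)
  have h3 : (Dsub F m n').relIndex (Phi m n').ker = Nat.card (RUgrp F m n') :=
    card_eq_of_surj (Mset.f (m := m) (n' := n')) Mset.g (Mset.f_surj hm hn') (Mset.g_surj hm hn')
      (Mset.f_iff_g hm hn')
  rw [h1, ← Subgroup.relIndex_mul_index (D_le hm hn'), h2, h3, mul_comm]

end Stmt5

variable (F)

/-- `#Q_{m,n} = h⁺ · h · #((R_m × R_{n/m})/U)`. -/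
theorem stmt5 (m n' : Ideal (𝓞 F)) (hm : m ≠ ⊥) (hn' : n' ≠ ⊥) :
    Nat.card (Qgrp F m n') =
      Nat.card (ClPlus F) * Nat.card (ClassGroup (𝓞 F)) * Nat.card (RUgrp F m n') := by
  exact Stmt5.main hm hn'

end
end

section
/- Let F be a number field, n a nonzero integral ideal, and A = [[a,b],[c,d]] a 2×2 matrix over F with totally positive determinant, together with λ in the narrow class group, determining the fractional ideal b_A = aO_F + c(t_λ d)^{-1} and the integral ideal c_A = c(t_λ d b_A)^{-1}, and m_A = gcd(c_A, n). Suppose (m_A, n) is not admissible, i.e. there exist units ε_1, ε_2 ∈ O_F^* with ε_1 ≡ 1 mod m_A, ε_2 ≡ 1 mod n/m_A, N(ε_1) = N(ε_2) = −1, and ε_1/ε_2 totally positive. Then the class of A in Γ_{1,λ}(n)\GL_2^+(F) is fixed by right multiplication by some upper triangular matrix A' = [[x,y],[0,z]] ∈ GL_2^+(F) with N(z) < 0. -/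
open NumberField FractionalIdeal
open scoped nonZeroDivisors

noncomputable section

variable (F : Type*) [Field F] [NumberField F]

/-- The different ideal of `F`, as a fractional ideal. -/
def diffIdl : FractionalIdeal (𝓞 F)⁰ F :=
  (differentIdeal ℤ (𝓞 F) : FractionalIdeal (𝓞 F)⁰ F)

/-- The congruence subgroup `Γ_{1,λ}(n)` (for the representative `tl` of `λ`):
matrices `[[a,b],[c,d]]` with totally positive determinant, `a, d ∈ O_F`,
`c ∈ t_λ d n`, `b ∈ (t_λ d)⁻¹`, `ad − bc ∈ O_F^*` and `d ≡ 1 mod n`. -/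
def Gamma (tl : FractionalIdeal (𝓞 F)⁰ F) (n : Ideal (𝓞 F)) :
    Set (Matrix (Fin 2) (Fin 2) F) :=
  {M | (∃ r : 𝓞 F, (r : F) = M 0 0) ∧ (∃ r : 𝓞 F, (r : F) = M 1 1) ∧
    M 1 0 ∈ tl * diffIdl F * (n : FractionalIdeal (𝓞 F)⁰ F) ∧
    M 0 1 ∈ (tl * diffIdl F)⁻¹ ∧
    (∃ u : (𝓞 F)ˣ, ((u : 𝓞 F) : F) = M.det) ∧
    TotPos F M.det ∧
    M 1 1 - 1 ∈ (n : FractionalIdeal (𝓞 F)⁰ F)}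

/-- If the pair `(m_A, n)` is not admissible, then the class of `A` in
`Γ_{1,λ}(n)\GL₂⁺(F)` is fixed by right multiplication by an upper triangular matrix
`A' = [[x,y],[0,z]] ∈ GL₂⁺(F)` with `N(z) < 0`.  Here `b_A = a O_F + c (t_λ d)⁻¹`,
`c_A = c (t_λ d b_A)⁻¹` and `m_A = gcd(c_A, n) = c_A + n`. -/
theorem stmt10 (tl : FractionalIdeal (𝓞 F)⁰ F) (htl : tl ≠ 0)
    (n : Ideal (𝓞 F)) (hn : n ≠ ⊥)
    (A : Matrix (Fin 2) (Fin 2) F)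
    (hAdet : TotPos F A.det) (hA0 : A.det ≠ 0)
    (bA : FractionalIdeal (𝓞 F)⁰ F)
    (hbA : bA = spanSingleton (𝓞 F)⁰ (A 0 0) +
      spanSingleton (𝓞 F)⁰ (A 1 0) * (tl * diffIdl F)⁻¹)
    (cA : Ideal (𝓞 F))
    (hcA : (cA : FractionalIdeal (𝓞 F)⁰ F) =
      spanSingleton (𝓞 F)⁰ (A 1 0) * (tl * diffIdl F * bA)⁻¹)
    -- non-admissibility of `(m_A, n)` with `m_A = cA + n`:
    (hnotadm : ∃ n' : Ideal (𝓞 F), (cA + n) * n' = n ∧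
      ∃ ε₁ ε₂ : (𝓞 F)ˣ,
        (ε₁ : 𝓞 F) - 1 ∈ cA + n ∧ (ε₂ : 𝓞 F) - 1 ∈ n' ∧
        Algebra.norm ℤ ((ε₁ : 𝓞 F)) = -1 ∧ Algebra.norm ℤ ((ε₂ : 𝓞 F)) = -1 ∧
        TotPos F (((ε₁ * ε₂⁻¹ : (𝓞 F)ˣ) : 𝓞 F) : F)) :
    ∃ A' : Matrix (Fin 2) (Fin 2) F,
      A' 1 0 = 0 ∧ TotPos F A'.det ∧
      Algebra.norm ℚ (A' 1 1) < 0 ∧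
      ∃ γ ∈ Gamma F tl n, γ * A = A * A' := by
  have addm : ∀ {I : FractionalIdeal (𝓞 F)⁰ F} {s t : F}, s ∈ I → t ∈ I → s + t ∈ I :=
    fun {I _ _} hs ht => Submodule.add_mem (I : Submodule (𝓞 F) F) hs ht
  have subm : ∀ {I : FractionalIdeal (𝓞 F)⁰ F} {s t : F}, s ∈ I → t ∈ I → s - t ∈ I :=
    fun {I _ _} hs ht => Submodule.sub_mem (I : Submodule (𝓞 F) F) hs ht
  have negm : ∀ {I : FractionalIdeal (𝓞 F)⁰ F} {s : F}, s ∈ I → -s ∈ I :=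
    fun {I _} hs => Submodule.neg_mem (I : Submodule (𝓞 F) F) hs
  obtain ⟨n', hn', ε₁, ε₂, h1, h2, hN1, -, hpos⟩ := hnotadm
  set D : FractionalIdeal (𝓞 F)⁰ F := tl * diffIdl F with hD
  have hd0 : diffIdl F ≠ 0 := by
    unfold diffIdl
    exact coeIdeal_ne_zero.mpr differentIdeal_ne_bot
  have hD0 : D ≠ 0 := mul_ne_zero htl hd0
  have ha : A 0 0 ∈ bA := by
    rw [hbA, mem_add]
    exact ⟨_, mem_spanSingleton_self _ _, 0, zero_mem _, by simp⟩
  have hcD : spanSingleton (𝓞 F)⁰ (A 1 0) ≤ D * bA := by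
    have : spanSingleton (𝓞 F)⁰ (A 1 0) * D⁻¹ ≤ bA := by
      rw [hbA]; exact le_sup_right
    calc spanSingleton (𝓞 F)⁰ (A 1 0) = D * (spanSingleton (𝓞 F)⁰ (A 1 0) * D⁻¹) := by
          field_simp
      _ ≤ _ := mul_le_mul_right this _
  have hc : A 1 0 ∈ D * bA := hcD (mem_spanSingleton_self _ _)
  have hb0 : bA ≠ 0 := by
    intro h
    rw [h] at ha hc
    rw [mul_zero] at hc
    rw [mem_zero_iff] at ha hc
    exact hA0 (by rw [Matrix.det_fin_two, ha, hc]; ring)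
  -- the dual vector
  have hone : (1 : F) ∈ spanSingleton (𝓞 F)⁰ (A 0 0) * bA⁻¹ +
      spanSingleton (𝓞 F)⁰ (A 1 0) * (D⁻¹ * bA⁻¹) := by
    rw [← mul_assoc, ← add_mul, ← hbA, mul_inv_cancel₀ hb0]
    exact one_mem_one _
  obtain ⟨_, hi, _, hj, hij⟩ := (mem_add _ _ _).mp hone
  obtain ⟨α, hα, rfl⟩ := mem_singleton_mul.mp hi
  obtain ⟨β, hβ, rfl⟩ := mem_singleton_mul.mp hj
  set x : F := ((ε₂ : 𝓞 F) : F) with hx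
  set z : F := ((ε₁ : 𝓞 F) : F) with hz
  have hx1 : x - 1 ∈ (n' : FractionalIdeal (𝓞 F)⁰ F) :=
    (mem_coeIdeal _).mpr ⟨_, h2, by simp [hx]⟩
  have hz1 : z - 1 ∈ (cA : FractionalIdeal (𝓞 F)⁰ F) + (n : FractionalIdeal (𝓞 F)⁰ F) := by
    rw [← coeIdeal_sup]
    exact (mem_coeIdeal _).mpr ⟨_, h1, by simp [hz]⟩
  have hn'c : (n' : FractionalIdeal (𝓞 F)⁰ F) * (cA : FractionalIdeal (𝓞 F)⁰ F) ≤ n := by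
    rw [← coeIdeal_mul, coeIdeal_le_coeIdeal]
    calc n' * cA ≤ n' * (cA + n) := Ideal.mul_mono_right le_sup_left
      _ = n := by rw [mul_comm, hn']
  have hcA1 : (cA : FractionalIdeal (𝓞 F)⁰ F) ≤ 1 := coeIdeal_le_one
  have hn1 : (n : FractionalIdeal (𝓞 F)⁰ F) ≤ 1 := coeIdeal_le_one
  -- spanSingleton c = cA * D * bA
  have hcs : spanSingleton (𝓞 F)⁰ (A 1 0) = cA * D * bA := by
    rw [hcA]; field_simp
  have hcm : A 1 0 ∈ (cA : FractionalIdeal (𝓞 F)⁰ F) * D * bA :=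
    hcs ▸ mem_spanSingleton_self _ _
  have hmem : -((z - 1) * α) ∈ spanSingleton (𝓞 F)⁰ (A 1 0) * (D⁻¹ * bA⁻¹ * bA⁻¹) +
      (n : FractionalIdeal (𝓞 F)⁰ F) * bA⁻¹ := by
    have e : spanSingleton (𝓞 F)⁰ (A 1 0) * (D⁻¹ * bA⁻¹ * bA⁻¹) +
      (n : FractionalIdeal (𝓞 F)⁰ F) * bA⁻¹ = (cA + n) * bA⁻¹ := by
      rw [hcs]; field_simp
    rw [e]
    exact negm (mul_mem_mul hz1 hα)
  obtain ⟨_, hi', δ, hδ, hδe⟩ := (mem_add _ _ _).mp hmem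
  obtain ⟨y, hy, rfl⟩ := mem_singleton_mul.mp hi'
  have hO : ∀ t : F, t ∈ (1 : FractionalIdeal (𝓞 F)⁰ F) → ∃ r : 𝓞 F, (r : F) = t := by
    intro t ht
    obtain ⟨r, hr⟩ := (mem_one_iff _).mp ht
    exact ⟨r, hr⟩
  have hxO : x ∈ (1 : FractionalIdeal (𝓞 F)⁰ F) := (mem_one_iff _).mpr ⟨_, rfl⟩
  have hzO : z ∈ (1 : FractionalIdeal (𝓞 F)⁰ F) := (mem_one_iff _).mpr ⟨_, rfl⟩
  have hxzO : x - z ∈ (1 : FractionalIdeal (𝓞 F)⁰ F) := subm hxO hzO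
  have hpx : TotPos F (x * z) := by
    intro φ
    have h := hpos φ
    have e : x * z = (((ε₁ * ε₂⁻¹ : (𝓞 F)ˣ) : 𝓞 F) : F) * (x * x) := by
      have : z = (((ε₁ * ε₂⁻¹ : (𝓞 F)ˣ) : 𝓞 F) : F) * x := by
        rw [hx, hz, ← map_mul, ← Units.val_mul, inv_mul_cancel_right]
      rw [this]; ring
    rw [e, map_mul, map_mul]
    have hx0 : φ x ≠ 0 := by
      rw [_root_.map_ne_zero, hx]
      exact (map_ne_zero_iff _ RingOfIntegers.coe_injective).mpr ε₂.ne_zero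
    exact mul_pos h (mul_self_pos.mpr hx0)
  have key : ∀ (I J K : FractionalIdeal (𝓞 F)⁰ F) (s t : F), s ∈ I → t ∈ J → I * J ≤ K →
      s * t ∈ K := fun I J K s t hs ht h => h (mul_mem_mul hs ht)
  have hm00 : z + (x - z) * (A 0 0 * α) - y * (A 0 0 * A 1 0) ∈
      (1 : FractionalIdeal (𝓞 F)⁰ F) := by
    refine subm (addm hzO (key _ _ _ _ _ hxzO (mul_mem_mul ha hα) ?_))
      (key _ _ _ _ _ hy (mul_mem_mul ha hc) ?_)
    · apply le_of_eq; field_simp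
    · apply le_of_eq; field_simp
  have hm01 : (x - z) * (A 0 0 * β) + y * (A 0 0 * A 0 0) ∈ D⁻¹ := by
    refine addm (key _ _ _ _ _ hxzO (mul_mem_mul ha hβ) ?_)
      (key _ _ _ _ _ hy (mul_mem_mul ha ha) ?_)
    · apply le_of_eq; field_simp
    · apply le_of_eq; field_simp
  have hm10 : (x - z) * (A 1 0 * α) - y * (A 1 0 * A 1 0) ∈
      D * (n : FractionalIdeal (𝓞 F)⁰ F) := by
    have e : (x - z) * (A 1 0 * α) - y * (A 1 0 * A 1 0) =
        (x - 1) * (A 1 0 * α) + A 1 0 * δ := by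
      linear_combination (-(A 1 0)) * hδe
    rw [e]
    refine addm (key _ _ _ _ _ hx1 (mul_mem_mul hcm hα) ?_) (key _ _ _ _ _ hc hδ ?_)
    · calc _ = D * ((n' : FractionalIdeal (𝓞 F)⁰ F) * cA) := by field_simp
        _ ≤ _ := mul_le_mul_right hn'c _
    · apply le_of_eq; field_simp
  have hm11 : z + (x - z) * (A 1 0 * β) + y * (A 0 0 * A 1 0) - 1 ∈
      (n : FractionalIdeal (𝓞 F)⁰ F) := by
    have e : z + (x - z) * (A 1 0 * β) + y * (A 0 0 * A 1 0) - 1 =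
        (x - 1) * (A 1 0 * β) - A 0 0 * δ := by
      linear_combination A 0 0 * hδe + (1 - z) * hij
    rw [e]
    refine subm (key _ _ _ _ _ hx1 (mul_mem_mul hcm hβ) ?_) (key _ _ _ _ _ ha hδ ?_)
    · refine le_trans (le_of_eq ?_) hn'c
      field_simp
    · apply le_of_eq; field_simp
  have hdet : (!![z + (x - z) * (A 0 0 * α) - y * (A 0 0 * A 1 0),
      (x - z) * (A 0 0 * β) + y * (A 0 0 * A 0 0);
      (x - z) * (A 1 0 * α) - y * (A 1 0 * A 1 0),
      z + (x - z) * (A 1 0 * β) + y * (A 0 0 * A 1 0)] : Matrix (Fin 2) (Fin 2) F).det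
      = x * z := by
    rw [Matrix.det_fin_two_of]
    linear_combination (x - z) * z * hij
  refine ⟨!![x, (x - z) * (α * A 0 1 + β * A 1 1) + y * A.det; 0, z], by simp, ?_, ?_,
    !![z + (x - z) * (A 0 0 * α) - y * (A 0 0 * A 1 0),
      (x - z) * (A 0 0 * β) + y * (A 0 0 * A 0 0);
      (x - z) * (A 1 0 * α) - y * (A 1 0 * A 1 0),
      z + (x - z) * (A 1 0 * β) + y * (A 0 0 * A 1 0)],
    ⟨?_, ?_, hm10, hm01, ?_, ?_, hm11⟩, ?_⟩
  · rw [Matrix.det_fin_two_of]; simpa using hpx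
  · have : Algebra.norm ℚ z = ((Algebra.norm ℤ (ε₁ : 𝓞 F) : ℤ) : ℚ) :=
      (Algebra.coe_norm_int _).symm
    simp [this, hN1]
  · exact hO _ hm00
  · refine hO _ ?_
    have := addm (hn1 hm11) (one_mem_one (𝓞 F)⁰)
    simpa using this
  · refine ⟨ε₂ * ε₁, ?_⟩
    rw [hdet]; simp [hx, hz]
  · rw [hdet]; exact hpx
  · ext i j
    fin_cases i <;> fin_cases j <;>
      simp [Matrix.mul_apply, Fin.sum_univ_two, Matrix.det_fin_two]
    · linear_combination (x - z) * A 0 0 * hij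
    · ring
    · linear_combination (x - z) * A 1 0 * hij
    · ring
end
end

section
/- Let F be a number field and n a nonzero integral ideal. With m_A = gcd(c_A, n) as above, the set of cusps cusps(n) = ⊔_{λ ∈ Cl^+(F)} Γ_{1,λ}(n)\P¹(F) decomposes as a disjoint union ⊔_{m | n} Q̃_{m,n}, where Q̃_{m,n} is the set of cusps [A] with m_A = m, and each stratum Q̃_{m,n} has cardinality equal to #Q_{m,n}, the quotient of G_m^+ × G_{n/m}^+ by the diagonal image of principal ideals (x) with x ≡ 1 mod n. In particular, #cusps(n) = Σ_{m | n} #Q_{m,n}. -/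
open NumberField FractionalIdeal
open scoped nonZeroDivisors

noncomputable section

variable (F : Type*) [Field F] [NumberField F]

/-- Nonzero vectors, representing points of `P¹(F)` by homogeneous coordinates. -/
def Vnz : Type _ := {v : Fin 2 → F // v ≠ 0}

/-- The component of the set of cusps at `λ`: `Γ_{1,λ}(n)\P¹(F)`, realized as the
quotient of `F² \ {0}` by `Γ_{1,λ}(n)` and scalars. -/
def CuspComp (tl : FractionalIdeal (𝓞 F)⁰ F) (n : Ideal (𝓞 F)) : Type _ :=
  Quot (fun v w : Vnz F => ∃ γ ∈ Gamma F tl n, ∃ s : Fˣ,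
    Matrix.mulVec γ v.1 = (s : F) • w.1)

/-- The set of cusps `cusps(n) = ⊔_{λ ∈ Cl⁺(F)} Γ_{1,λ}(n)\P¹(F)`, for a choice `t`
of representative fractional ideals. -/
def Cusps (t : ClPlus F → Idl F) (n : Ideal (𝓞 F)) : Type _ :=
  Σ l : ClPlus F, CuspComp F ((t l : Idl F) : FractionalIdeal (𝓞 F)⁰ F) n

/-- The fractional ideal `b_{(a,c)} = a O_F + c (t_λ d)⁻¹`. -/
def bA (tl : FractionalIdeal (𝓞 F)⁰ F) (v : Fin 2 → F) : FractionalIdeal (𝓞 F)⁰ F :=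
  spanSingleton (𝓞 F)⁰ (v 0) + spanSingleton (𝓞 F)⁰ (v 1) * (tl * diffIdl F)⁻¹

open Classical in
/-- The integral ideal `c_{(a,c)}` with `(c_A) = c (t_λ d b_A)⁻¹`. -/
def cIdeal (tl : FractionalIdeal (𝓞 F)⁰ F) (v : Fin 2 → F) : Ideal (𝓞 F) :=
  if h : ∃ I : Ideal (𝓞 F), (I : FractionalIdeal (𝓞 F)⁰ F) =
      spanSingleton (𝓞 F)⁰ (v 1) * (tl * diffIdl F * bA F tl v)⁻¹
  then h.choose else ⊥

/-- `m_A = gcd(c_A, n) = c_A + n`. -/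
def mA (tl : FractionalIdeal (𝓞 F)⁰ F) (n : Ideal (𝓞 F)) (v : Fin 2 → F) :
    Ideal (𝓞 F) := cIdeal F tl v + n

/-- The stratum `𝔔_{m,n}` of cusps with invariant `m_A = m`. -/
def Stratum (t : ClPlus F → Idl F) (n m : Ideal (𝓞 F)) : Set (Cusps F t n) :=
  {x | ∃ v : Vnz F, Quot.mk _ v = x.2 ∧
    mA F ((t x.1 : Idl F) : FractionalIdeal (𝓞 F)⁰ F) n v.1 = m}

set_option linter.unusedSectionVars false
section helpers
variable {F}

/-- Fractional ideals of `F`. -/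
abbrev FI (F : Type*) [Field F] [NumberField F] := FractionalIdeal (𝓞 F)⁰ F

/-- Principal fractional ideals. -/
abbrev sp (x : F) : FI F := spanSingleton (𝓞 F)⁰ x

lemma mm {I J K : FI F} {x y : F} (hx : x ∈ I) (hy : y ∈ J) (h : I * J ≤ K) : x * y ∈ K :=
  h (FractionalIdeal.mul_mem_mul hx hy)

lemma fadd {I : FI F} {x y : F} (hx : x ∈ I) (hy : y ∈ I) : x + y ∈ I :=
  I.coeToSubmodule.add_mem hx hy

lemma fsub {I : FI F} {x y : F} (hx : x ∈ I) (hy : y ∈ I) : x - y ∈ I :=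
  I.coeToSubmodule.sub_mem hx hy

lemma fneg {I : FI F} {x : F} (hx : x ∈ I) : -x ∈ I :=
  I.coeToSubmodule.neg_mem hx

lemma fzero {I : FI F} : (0 : F) ∈ I := I.coeToSubmodule.zero_mem

lemma fint {I : FI F} {x : F} (r : 𝓞 F) (hx : x ∈ I) : (r : F) * x ∈ I := by
  have := I.coeToSubmodule.smul_mem r hx
  rw [Algebra.smul_def] at this
  exact this

lemma sp_le {x : F} {I : FI F} : sp x ≤ I ↔ x ∈ I := spanSingleton_le_iff_mem

lemma sp_ne {x : F} (hx : x ≠ 0) : sp x ≠ 0 := spanSingleton_ne_zero_iff.mpr hx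

lemma mem_sp (x : F) : x ∈ sp x := mem_spanSingleton_self _ x

lemma sp_mul (x y : F) : sp (x * y) = sp x * sp y := (spanSingleton_mul_spanSingleton x y).symm

lemma sp_inv (x : F) : sp (x⁻¹) = (sp x)⁻¹ := by
  simp [sp, FractionalIdeal.spanSingleton_inv]

lemma mem_sp_mul {x z : F} {I : FI F} : z ∈ sp x * I ↔ ∃ y ∈ I, z = x * y :=
  mem_singleton_mul

lemma le_cancel {I J K : FI F} (hK : K ≠ 0) (h : I * K ≤ J * K) : I ≤ J :=
  le_of_mul_le_mul_right h (bot_lt_iff_ne_bot.mpr hK)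

lemma mem_idl {x : 𝓞 F} {c : Ideal (𝓞 F)} : (x : F) ∈ (c : FI F) ↔ x ∈ c := by
  rw [mem_coeIdeal]
  constructor
  · rintro ⟨y, hy, h⟩
    rwa [← RingOfIntegers.ext h]
  · intro h; exact ⟨x, h, rfl⟩

lemma mem_idl_iff {x : F} {c : Ideal (𝓞 F)} : x ∈ (c : FI F) ↔ ∃ r : 𝓞 F, r ∈ c ∧ (r : F) = x :=
  mem_coeIdeal _

lemma mem_one_int {x : F} : x ∈ (1 : FI F) ↔ ∃ r : 𝓞 F, (r : F) = x := mem_one_iff _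

lemma idl_le_one (c : Ideal (𝓞 F)) : (c : FI F) ≤ 1 := coeIdeal_le_one

lemma idl_ne {c : Ideal (𝓞 F)} (hc : c ≠ ⊥) : (c : FI F) ≠ 0 := coeIdeal_ne_zero.mpr hc

lemma exists_nat_mem {I : FI F} (hI : I ≠ 0) : ∃ N : ℕ, 0 < N ∧ (N : F) ∈ I := by
  obtain ⟨x, hx, hxI⟩ := FractionalIdeal.exists_ne_zero_mem_isInteger hI
  refine ⟨Ideal.absNorm (Ideal.span {x}), ?_, ?_⟩
  · rw [Nat.pos_iff_ne_zero, Ne, Ideal.absNorm_eq_zero_iff]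
    simpa using hx
  · have := Ideal.absNorm_mem (Ideal.span {x})
    rw [Ideal.mem_span_singleton'] at this
    obtain ⟨a, ha⟩ := this
    have h2 := fint a hxI
    rw [show ((a : F) * algebraMap (𝓞 F) F x) = ((a * x : 𝓞 F) : F) by simp, ha] at h2
    simpa using h2

lemma exists_large (a : F) : ∃ k0 : ℕ, ∀ k ≥ k0, ∀ φ : F →+* ℝ, |φ a| < k := by
  obtain ⟨M, hM⟩ := (Set.finite_range (fun φ : F →+* ℝ => |φ a|)).bddAbove
  obtain ⟨k, hk⟩ := exists_nat_gt M
  refine ⟨k, fun j hj φ => ?_⟩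
  have h1 := hM ⟨φ, rfl⟩
  have h2 : (k : ℝ) ≤ j := by exact_mod_cast hj
  simp only at h1
  linarith

/-- shift an element by an ideal to make it totally positive and non-zero -/
lemma exists_shift (a : F) {I : FI F} (hI : I ≠ 0) :
    ∃ b : F, b - a ∈ I ∧ b ≠ 0 ∧ TotPos F b := by
  obtain ⟨N, hN, hNI⟩ := exists_nat_mem hI
  obtain ⟨k0, hk⟩ := exists_large a
  have hpos : ∀ k ≥ k0, TotPos F (a + k * N) := by
    intro k hkk φ
    have h1 := hk k hkk φ
    have h2 : (1 : ℝ) ≤ N := by exact_mod_cast hN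
    have h3 := (abs_lt.mp h1).1
    simp only [map_add, map_mul, map_natCast]
    have : (k : ℝ) ≤ k * N := le_mul_of_one_le_right (by positivity) h2
    linarith
  have hmem : ∀ k : ℕ, (a + k * N) - a ∈ I := by
    intro k
    have := fint (k : 𝓞 F) hNI
    simpa using this
  by_cases h : a + k0 * N = 0
  · refine ⟨a + (k0 + 1 : ℕ) * N, hmem _, ?_, hpos _ (by omega)⟩
    intro h'
    have h0 : (N : F) = 0 := by
      push_cast at h'
      linear_combination h' - h
    have : N = 0 := by exact_mod_cast h0
    omega
  · exact ⟨_, hmem k0, h, hpos _ le_rfl⟩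

/-- an element congruent to one modulo `n` with prescribed signs -/
lemma exists_sign {x : F} (hx : x ≠ 0) {n : Ideal (𝓞 F)} (hn : n ≠ ⊥) :
    ∃ y : 𝓞 F, y ≠ 0 ∧ y - 1 ∈ n ∧ TotPos F (x * y) := by
  obtain ⟨N, hN, hNn⟩ := exists_nat_mem (idl_ne (F := F) hn)
  obtain ⟨p, q, hq, hpq⟩ := IsFractionRing.div_surjective (A := 𝓞 F) x
  have hq0 : (q : F) ≠ 0 := by simpa using nonZeroDivisors.ne_zero hq
  have hpx : (p : F) = x * q := by rw [← hpq]; field_simp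
  set a : F := x * q ^ 2 with ha
  have ha0 : a ≠ 0 := by positivity
  have hai : a = ((p * q : 𝓞 F) : F) := by simp [ha, hpx]; ring
  obtain ⟨k0, hk⟩ := exists_large (a⁻¹)
  have key : ∀ k ≥ k0, TotPos F (x * (1 + k * N * a)) := by
    intro k hkk φ
    have h1 := hk k hkk φ
    have h2 : (1 : ℝ) ≤ N := by exact_mod_cast hN
    have h3 := (abs_lt.mp h1).1
    have hφa : φ a ≠ 0 := by simpa using ha0
    have hφq : φ q ≠ 0 := by simpa using hq0
    have e : φ (x * (1 + k * N * a)) = (φ a) ^ 2 / (φ q) ^ 2 * (φ (a⁻¹) + k * N) := by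
      have : φ a = φ x * φ q ^ 2 := by simp [ha]
      have hφx : φ x ≠ 0 := by simpa using hx
      simp only [map_add, map_mul, map_natCast, map_one, map_inv₀]
      rw [this]
      field_simp
    rw [e]
    have : (k : ℝ) ≤ k * N := le_mul_of_one_le_right (by positivity) h2
    have : 0 < φ (a⁻¹) + k * N := by linarith
    positivity
  have hmem : ∀ k : ℕ, (1 + k * N * (p * q) : 𝓞 F) - 1 ∈ n := by
    intro k
    have : (N : 𝓞 F) ∈ n := by
      rw [← mem_idl]; simpa using hNn
    rw [add_sub_cancel_left]
    exact n.mul_mem_right _ (n.mul_mem_left _ this)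
  have hcast : ∀ k : ℕ, ((1 + k * N * (p * q) : 𝓞 F) : F) = 1 + k * N * a := by
    intro k; rw [hai]; simp
  by_cases h : (1 + k0 * N * (p * q) : 𝓞 F) = 0
  · refine ⟨(1 + (k0 + 1 : ℕ) * N * (p * q) : 𝓞 F), ?_, hmem _, ?_⟩
    · intro h'
      have h0 : (N * (p * q) : 𝓞 F) = 0 := by
        push_cast at h'
        linear_combination h' - h
      have h1 : (N * a : F) = 0 := by
        rw [hai]; exact_mod_cast congrArg (fun z : 𝓞 F => (z : F)) h0
      have : (N : F) = 0 := by simpa [ha0] using h1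
      have : N = 0 := by exact_mod_cast this
      omega
    · rw [hcast]; exact key _ (by omega)
  · exact ⟨_, h, hmem k0, by rw [hcast]; exact key _ le_rfl⟩

lemma exists_gen {I : FI F} (hI : I ≠ 0) {c : Ideal (𝓞 F)} (hc : c ≠ ⊥) :
    ∃ g ∈ I, sp g + c * I = I := by
  obtain ⟨a, J, ha, hJ⟩ := FractionalIdeal.exists_eq_spanSingleton_mul I
  have ha' : algebraMap (𝓞 F) F a ≠ 0 := by simpa using ha
  have hJ0 : J ≠ ⊥ := by
    rintro rfl
    apply hI; rw [hJ]; simp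
  obtain ⟨b, hb⟩ := IsDedekindDomain.exists_sup_span_eq (I := c * J) (J := J)
    Ideal.mul_le_right (by simpa using ⟨hc, hJ0⟩)
  have key : sp ((algebraMap (𝓞 F) F a)⁻¹ * (b : F)) + c * I = I := by
    have e : (J : FI F) = c * J + sp (b : F) := by
      conv_lhs => rw [← hb]
      rw [coeIdeal_sup, coeIdeal_mul, coeIdeal_span_singleton]
    conv_rhs => rw [hJ, e]
    rw [hJ, sp_mul]
    ring
  refine ⟨_, ?_, key⟩
  rw [← sp_le]
  conv_rhs => rw [← key]
  exact le_self_add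

lemma lift_coprime {m C : Ideal (𝓞 F)} (hC : C ≠ ⊥) {e : 𝓞 F} (he : Ideal.span {e} + m = ⊤) :
    ∃ s ∈ m, Ideal.span {e + s} + C = ⊤ := by
  classical
  have hfin : {P : Ideal (𝓞 F) | P.IsPrime ∧ C ≤ P}.Finite := by
    have hf : Finite {P : Ideal (𝓞 F) // P ∣ C} :=
      @Finite.of_fintype _ (UniqueFactorizationMonoid.fintypeSubtypeDvd C hC)
    refine (show {P : Ideal (𝓞 F) | P ∣ C}.Finite from hf).subset ?_
    rintro P ⟨_, h⟩
    exact Ideal.dvd_iff_le.mpr h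
  set S := hfin.toFinset with hS
  set B := S.filter (fun P => e ∈ P) with hB
  set G := S.filter (fun P => e ∉ P) with hG
  have hprime : ∀ P ∈ S, P.IsPrime := fun P hP => (hfin.mem_toFinset.mp hP).1
  have hle : ∀ P ∈ S, C ≤ P := fun P hP => (hfin.mem_toFinset.mp hP).2
  have hmax : ∀ P ∈ S, P.IsMaximal := fun P hP =>
    (hprime P hP).isMaximal (fun h => hC (by have := hle P hP; rw [h] at this; exact le_bot_iff.mp this))
  have hnot : ¬ ((m * ∏ P ∈ G, P : Ideal (𝓞 F)) : Set (𝓞 F)) ⊆ ⋃ P ∈ (B : Set (Ideal (𝓞 F))), (id P : Ideal (𝓞 F)) := by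
    intro hsub
    have hsub := (Ideal.subset_union_prime (s := B) (f := id) ⊥ ⊥ (fun P hP _ _ => hprime P (Finset.mem_of_mem_filter P hP))).mp hsub
    obtain ⟨P, hPB, hP⟩ := hsub
    have hPS := Finset.mem_of_mem_filter P hPB
    have hPe : e ∈ P := (Finset.mem_filter.mp hPB).2
    have hp := hprime P hPS
    rcases (hp.mul_le).mp hP with h | h
    · apply hp.ne_top
      rw [eq_top_iff, ← he]
      exact sup_le ((Ideal.span_singleton_le_iff_mem _).mpr hPe) h
    · rw [hp.prod_le] at h
      obtain ⟨Q, hQ, hQP⟩ := h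
      have hQS := Finset.mem_of_mem_filter Q hQ
      have := (hmax Q hQS).eq_of_le hp.ne_top hQP
      exact (Finset.mem_filter.mp hQ).2 (this ▸ hPe)
  rw [Set.not_subset] at hnot
  obtain ⟨s, hs, hsn⟩ := hnot
  refine ⟨s, Ideal.mul_le_left hs, ?_⟩
  by_contra hne
  obtain ⟨P, hPm, hP⟩ := Ideal.exists_le_maximal _ hne
  have hPS : P ∈ S := hfin.mem_toFinset.mpr ⟨hPm.isPrime, le_trans le_sup_right hP⟩
  have h1 : e + s ∈ P := hP (Ideal.mem_sup_left (Ideal.mem_span_singleton_self _))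
  by_cases heP : e ∈ P
  · apply hsn
    simp only [Set.mem_iUnion]
    exact ⟨P, by simp [hB, hPS, heP], (P.add_mem_iff_right heP).mp h1⟩
  · have : s ∈ P := by
      have h2 : s ∈ ∏ P ∈ G, P := Ideal.mul_le_right hs
      exact Ideal.le_of_dvd (Finset.dvd_prod_of_mem (fun P => P) (by simp [hG, hPS, heP] : P ∈ G)) h2
    exact heP ((P.add_mem_iff_left this).mp h1)

end helpers

section helpers2
variable {F}

lemma c_mul (x y : 𝓞 F) : ((x * y : 𝓞 F) : F) = (x : F) * (y : F) := rfl
lemma c_add (x y : 𝓞 F) : ((x + y : 𝓞 F) : F) = (x : F) + (y : F) := rfl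
lemma c_sub (x y : 𝓞 F) : ((x - y : 𝓞 F) : F) = (x : F) - (y : F) := rfl
lemma c_neg (x : 𝓞 F) : ((-x : 𝓞 F) : F) = -(x : F) := rfl
lemma c_one : ((1 : 𝓞 F) : F) = 1 := rfl

lemma TotPos.mul' {x y : F} (hx : TotPos F x) (hy : TotPos F y) : TotPos F (x * y) := by
  intro φ; rw [map_mul]; exact mul_pos (hx φ) (hy φ)

lemma TotPos.inv' {x : F} (hx : TotPos F x) : TotPos F x⁻¹ := by
  intro φ; rw [map_inv₀]; exact inv_pos.mpr (hx φ)

lemma TotPos.of_sq {x y : F} (hy : y ≠ 0) (h : TotPos F (x * y ^ 2)) : TotPos F x := by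
  intro φ
  have h1 := h φ
  have h2 : φ y ≠ 0 := by simpa using hy
  rw [map_mul, map_pow] at h1
  exact pos_of_mul_pos_left h1 (by positivity)

lemma TotPos.one' : TotPos F 1 := by intro φ; simp

lemma TotPos.sq' {y : F} (hy : y ≠ 0) : TotPos F (y ^ 2) := by
  intro φ
  have h2 : φ y ≠ 0 := by simpa using hy
  rw [map_pow]; positivity

/-- Elements multiplicatively congruent to one modulo `c`. -/
def RR (c : Ideal (𝓞 F)) (x : F) : Prop :=
  ∃ p q : 𝓞 F, p ≠ 0 ∧ q ≠ 0 ∧ p - 1 ∈ c ∧ q - 1 ∈ c ∧ x * q = p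

lemma RR.ne_zero {c : Ideal (𝓞 F)} {x : F} (h : RR c x) : x ≠ 0 := by
  obtain ⟨p, q, hp, hq, -, -, h⟩ := h
  rintro rfl
  apply hp
  rw [zero_mul] at h
  exact_mod_cast h.symm

lemma mul_cong_one {c : Ideal (𝓞 F)} {x y : 𝓞 F} (hx : x - 1 ∈ c) (hy : y - 1 ∈ c) :
    x * y - 1 ∈ c := by
  have : x * y - 1 = y * (x - 1) + (y - 1) := by ring
  rw [this]
  exact c.add_mem (c.mul_mem_left _ hx) hy

lemma RR.one {c : Ideal (𝓞 F)} : RR c (1 : F) :=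
  ⟨1, 1, one_ne_zero, one_ne_zero, by simp, by simp, by simp⟩

lemma RR.mul {c : Ideal (𝓞 F)} {x y : F} (hx : RR c x) (hy : RR c y) : RR c (x * y) := by
  obtain ⟨p, q, hp, hq, hp', hq', h⟩ := hx
  obtain ⟨p2, q2, hp2, hq2, hp2', hq2', h2⟩ := hy
  refine ⟨p * p2, q * q2, mul_ne_zero hp hp2, mul_ne_zero hq hq2, mul_cong_one hp' hp2',
    mul_cong_one hq' hq2', ?_⟩
  rw [c_mul, c_mul, ← h, ← h2]; ring

lemma RR.inv {c : Ideal (𝓞 F)} {x : F} (hx : RR c x) : RR c x⁻¹ := by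
  have h0 := hx.ne_zero
  obtain ⟨p, q, hp, hq, hp', hq', h⟩ := hx
  refine ⟨q, p, hq, hp, hq', hp', ?_⟩
  rw [← h]; field_simp

lemma RR.of_int {c : Ideal (𝓞 F)} {x : 𝓞 F} (h0 : x ≠ 0) (hx : x - 1 ∈ c) : RR c (x : F) :=
  ⟨x, 1, h0, one_ne_zero, hx, by simp, by simp⟩

lemma int_ne {x : 𝓞 F} (h : x ≠ 0) : (x : F) ≠ 0 := by exact_mod_cast h

/-- The unit fractional ideal generated by a nonzero element. -/
def spu (x : F) (hx : x ≠ 0) : Idl F := Units.mk0 (sp x) (sp_ne hx)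

lemma spu_coe (x : F) (hx : x ≠ 0) : ((spu x hx : Idl F) : FI F) = sp x := rfl

lemma J_mem_int {c : Ideal (𝓞 F)} {x : 𝓞 F} (h0 : x ≠ 0) (hx : x - 1 ∈ c) :
    spu (x : F) (int_ne h0) ∈ Jgrp F c := by
  apply Subgroup.subset_closure
  refine ⟨Ideal.span {x}, ?_, ?_⟩
  · rw [Ideal.eq_top_iff_one]
    have : (1 : 𝓞 F) = x + -(x - 1) := by ring
    rw [this]
    exact Submodule.add_mem_sup (Ideal.mem_span_singleton_self x) (c.neg_mem hx)
  · rw [coeIdeal_span_singleton]; rfl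

lemma J_mem {c : Ideal (𝓞 F)} {u : Idl F} (hu : u ∈ Jgrp F c) :
    (∃ q : 𝓞 F, q - 1 ∈ c ∧ (q : F) ∈ (u : FI F)) ∧
    (∃ q : 𝓞 F, q - 1 ∈ c ∧ (q : F) ∈ ((u⁻¹ : Idl F) : FI F)) := by
  induction hu using Subgroup.closure_induction with
  | mem u hu =>
    obtain ⟨a, ha, hau⟩ := hu
    constructor
    · rw [Ideal.eq_top_iff_one] at ha
      obtain ⟨y, hy, z, hz, hyz⟩ := Submodule.mem_sup.mp ha
      refine ⟨y, ?_, ?_⟩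
      · have : y - 1 = -z := by rw [← hyz]; ring
        rw [this]; exact c.neg_mem hz
      · rw [hau]; exact mem_idl.mpr hy
    · refine ⟨1, by simp, ?_⟩
      have h1 : (u : FI F) ≤ 1 := by rw [hau]; exact idl_le_one a
      have h2 : (1 : FI F) ≤ ((u⁻¹ : Idl F) : FI F) := by
        have := mul_le_mul_left h1 ((u⁻¹ : Idl F) : FI F)
        simpa using this
      apply h2
      simp
  | one => exact ⟨⟨1, by simp, by simp⟩, ⟨1, by simp, by simp⟩⟩
  | mul u v _ _ hu hv =>
    obtain ⟨⟨q, hq, hqu⟩, ⟨r, hr, hru⟩⟩ := hu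
    obtain ⟨⟨q', hq', hqu'⟩, ⟨r', hr', hru'⟩⟩ := hv
    refine ⟨⟨q * q', mul_cong_one hq hq', ?_⟩, ⟨r * r', mul_cong_one hr hr', ?_⟩⟩
    · push_cast; exact FractionalIdeal.mul_mem_mul hqu hqu'
    · rw [mul_inv, c_mul, Units.val_mul]; exact FractionalIdeal.mul_mem_mul hru hru'
  | inv u _ hu => rw [inv_inv]; exact ⟨hu.2, hu.1⟩

lemma J_mem_pos {c : Ideal (𝓞 F)} (hc : c ≠ ⊥) {u : Idl F} (hu : u ∈ Jgrp F c) :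
    ∃ q : 𝓞 F, q ≠ 0 ∧ TotPos F (q : F) ∧ q - 1 ∈ c ∧ (q : F) ∈ (u : FI F) := by
  obtain ⟨⟨q, hq, hqu⟩, -⟩ := J_mem hu
  obtain ⟨⟨r, hr, hru⟩, -⟩ := J_mem hu
  set I : FI F := (u : FI F) ⊓ (c : FI F) with hI
  have hI0 : I ≠ 0 := by
    obtain ⟨N, hN, hNu⟩ := exists_nat_mem u.ne_zero
    obtain ⟨M, hM, hMc⟩ := exists_nat_mem (idl_ne (F := F) hc)
    intro h
    have : ((N * M : ℕ) : F) ∈ I := by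
      refine ⟨?_, ?_⟩
      · have := fint (M : 𝓞 F) hNu
        simpa [mul_comm] using this
      · have := fint (N : 𝓞 F) hMc
        simpa using this
    rw [h] at this
    have h0 := (FractionalIdeal.mem_zero_iff _).mp this
    have : N * M = 0 := by exact_mod_cast h0
    have := Nat.mul_pos hN hM
    omega
  obtain ⟨b, hb, hb0, hbp⟩ := exists_shift (q : F) hI0
  obtain ⟨s, hs, hsb⟩ := mem_idl_iff.mp hb.2
  have e : b = ((q + s : 𝓞 F) : F) := by 
    have hsb' : (s : F) = b - (q : F) := hsb
    rw [c_add]; linear_combination -hsb'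
  rw [e] at hb0 hbp
  refine ⟨q + s, by exact_mod_cast hb0, hbp, ?_, ?_⟩
  · have : q + s - 1 = (q - 1) + s := by ring
    rw [this]; exact c.add_mem hq hs
  · rw [← e]
    have := fadd hqu hb.1
    simpa using this

lemma J_of {c : Ideal (𝓞 F)} {u : Idl F} (h1 : (1 : F) ∈ (u : FI F))
    (h : (1 : FI F) ≤ (u : FI F)⁻¹ + c) : u ∈ Jgrp F c := by
  rw [← Subgroup.inv_mem_iff]
  apply Subgroup.subset_closure
  have hle : (u : FI F)⁻¹ ≤ 1 := by
    rw [← sp_le, sp, spanSingleton_one] at h1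
    have := mul_le_mul_left h1 ((u : FI F)⁻¹)
    simpa using this
  obtain ⟨I, hI⟩ := le_one_iff_exists_coeIdeal.mp hle
  refine ⟨I, ?_, ?_⟩
  · rw [← hI] at h
    rw [eq_top_iff, ← coeIdeal_le_coeIdeal F]
    have e : ((I + c : Ideal (𝓞 F)) : FI F) = I + c := coeIdeal_sup I c
    rw [e, coeIdeal_top]; exact h
  · rw [hI, Units.val_inv_eq_inv_val]

lemma ray_one {m n' : Ideal (𝓞 F)} {w : F} {P Q : 𝓞 F} (hP : P ≠ 0) (hQ : Q ≠ 0)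
    (hP1 : P - 1 ∈ m) (hQ1 : Q - 1 ∈ m) (hPp : TotPos F (P : F)) (hQp : TotPos F (Q : F))
    (hw : w * Q = P) {a : Jgrp F m} (ha : ((a : Idl F) : FI F) = sp w) :
    ((a, 1) : Jgrp F m × Jgrp F n') ∈ Dsub F m n' := by
  have e : ((a, 1) : Jgrp F m × Jgrp F n') = (⟨_, J_mem_int hP hP1⟩, 1) * (⟨_, J_mem_int hQ hQ1⟩, 1)⁻¹ := by
    rw [eq_mul_inv_iff_mul_eq]
    ext1
    · apply Subtype.ext; apply Units.ext
      simp only [Prod.mk_mul_mk, Subgroup.coe_mul, Units.val_mul, ha, spu_coe, ← sp_mul, hw]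
    · simp
  rw [e]
  refine mul_mem (Subgroup.subset_closure ?_) (inv_mem (Subgroup.subset_closure ?_))
  · exact Or.inl (Or.inl ⟨P, hPp, hP1, rfl, rfl⟩)
  · exact Or.inl (Or.inl ⟨Q, hQp, hQ1, rfl, rfl⟩)

lemma ray_two {m n' : Ideal (𝓞 F)} {w : F} {P Q : 𝓞 F} (hP : P ≠ 0) (hQ : Q ≠ 0)
    (hP1 : P - 1 ∈ n') (hQ1 : Q - 1 ∈ n') (hPp : TotPos F (P : F)) (hQp : TotPos F (Q : F))
    (hw : w * Q = P) {a : Jgrp F n'} (ha : ((a : Idl F) : FI F) = sp w) :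
    ((1, a) : Jgrp F m × Jgrp F n') ∈ Dsub F m n' := by
  have e : ((1, a) : Jgrp F m × Jgrp F n') = (1, ⟨_, J_mem_int hP hP1⟩) * (1, ⟨_, J_mem_int hQ hQ1⟩)⁻¹ := by
    rw [eq_mul_inv_iff_mul_eq]
    ext1
    · simp
    · apply Subtype.ext; apply Units.ext
      simp only [Prod.mk_mul_mk, Subgroup.coe_mul, Units.val_mul, ha, spu_coe, ← sp_mul, hw]
  rw [e]
  refine mul_mem (Subgroup.subset_closure ?_) (inv_mem (Subgroup.subset_closure ?_))
  · exact Or.inl (Or.inr ⟨P, hPp, hP1, rfl, rfl⟩)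
  · exact Or.inl (Or.inr ⟨Q, hQp, hQ1, rfl, rfl⟩)

/-- Normalize the quotient of an element of `RR` by `y` of the same sign. -/
lemma RR.normalize {c : Ideal (𝓞 F)} {x : F} (hx : RR c x) {y : 𝓞 F} (hy : y ≠ 0) (hy1 : y - 1 ∈ c)
    (hxy : TotPos F (x * y)) : ∃ P Q : 𝓞 F, P ≠ 0 ∧ Q ≠ 0 ∧ P - 1 ∈ c ∧ Q - 1 ∈ c ∧
      TotPos F (P : F) ∧ TotPos F (Q : F) ∧ (x * (y : F)⁻¹) * Q = P := by
  have hy' := int_ne hy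
  obtain ⟨p, q, hp, hq, hp1, hq1, h⟩ := hx
  have hq' := int_ne hq
  refine ⟨p * q * y, (q * y) * (q * y), by simp [*], by simp [*],
    mul_cong_one (mul_cong_one hp1 hq1) hy1,
    mul_cong_one (mul_cong_one hq1 hy1) (mul_cong_one hq1 hy1), ?_, ?_, ?_⟩
  · have : ((p * q * y : 𝓞 F) : F) = x * y * (q : F) ^ 2 := by simp only [c_mul]; rw [← h]; ring
    rw [this]; exact hxy.mul' (TotPos.sq' hq')
  · have : ((q * y * (q * y) : 𝓞 F) : F) = ((q : F) * y) ^ 2 := by simp only [c_mul]; ring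
    rw [this]; exact TotPos.sq' (mul_ne_zero hq' hy')
  · simp only [c_mul]; rw [← h]; field_simp

lemma Dsub_iff {m n' : Ideal (𝓞 F)} (h0 : m * n' ≠ ⊥) (p : Jgrp F m × Jgrp F n') :
    p ∈ Dsub F m n' ↔ ∃ x z : F, RR n' x ∧ RR m z ∧ TotPos F (x * z) ∧
      ((p.1 : Idl F) : FI F) = sp z ∧ ((p.2 : Idl F) : FI F) = sp x := by
  constructor
  · intro hp
    have sp_ne' : ∀ (u : Idl F) (x : 𝓞 F), (u : FI F) = sp (x : F) → x ≠ 0 := by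
      rintro u x h rfl
      apply u.ne_zero; rw [h]; simp [sp]
    induction hp using Subgroup.closure_induction with
    | mem p hp =>
      rcases hp with (⟨x, hx, hx1, h1, h2⟩ | ⟨y, hy, hy1, h1, h2⟩) | ⟨x, hx1, h1, h2⟩
      · exact ⟨1, x, RR.one, RR.of_int (sp_ne' _ _ h1) hx1, by simpa using hx, h1, by simp [h2, sp]⟩
      · exact ⟨y, 1, RR.of_int (sp_ne' _ _ h2) hy1, RR.one, by simpa using hy, by simp [h1, sp], h2⟩
      · refine ⟨x, x, RR.of_int (sp_ne' _ _ h2) (Ideal.mul_le_right hx1),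
          RR.of_int (sp_ne' _ _ h2) (Ideal.mul_le_left hx1), ?_, h1, h2⟩
        rw [← sq]; exact TotPos.sq' (int_ne (sp_ne' _ _ h2))
    | one => exact ⟨1, 1, RR.one, RR.one, by simpa using TotPos.one', by simp [sp], by simp [sp]⟩
    | mul a b _ _ ha hb =>
      obtain ⟨x, z, hx, hz, hxz, h1, h2⟩ := ha
      obtain ⟨x', z', hx', hz', hxz', h1', h2'⟩ := hb
      refine ⟨x * x', z * z', hx.mul hx', hz.mul hz', ?_, ?_, ?_⟩
      · have : x * x' * (z * z') = (x * z) * (x' * z') := by ring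
        rw [this]; exact hxz.mul' hxz'
      · rw [Prod.fst_mul, Subgroup.coe_mul, Units.val_mul, h1, h1', sp_mul]
      · rw [Prod.snd_mul, Subgroup.coe_mul, Units.val_mul, h2, h2', sp_mul]
    | inv a _ ha =>
      obtain ⟨x, z, hx, hz, hxz, h1, h2⟩ := ha
      refine ⟨x⁻¹, z⁻¹, hx.inv, hz.inv, ?_, ?_, ?_⟩
      · rw [← mul_inv]; exact hxz.inv'
      · rw [Prod.fst_inv, Subgroup.coe_inv, Units.val_inv_eq_inv_val, h1, sp_inv]
      · rw [Prod.snd_inv, Subgroup.coe_inv, Units.val_inv_eq_inv_val, h2, sp_inv]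
  · rintro ⟨x, z, hx, hz, hxz, h1, h2⟩
    obtain ⟨y, hy0, hy1, hxy⟩ := exists_sign hx.ne_zero h0
    have hzy : TotPos F (z * y) := by
      apply TotPos.of_sq hx.ne_zero
      have : z * y * x ^ 2 = (x * z) * (x * y) := by ring
      rw [this]; exact hxz.mul' hxy
    have hyn : y - 1 ∈ n' := Ideal.mul_le_right hy1
    have hym : y - 1 ∈ m := Ideal.mul_le_left hy1
    obtain ⟨P, Q, hP, hQ, hP1, hQ1, hPp, hQp, hPQ⟩ := hx.normalize hy0 hyn hxy
    obtain ⟨P', Q', hP', hQ', hP1', hQ1', hPp', hQp', hPQ'⟩ := hz.normalize hy0 hym hzy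
    let Y1 : Jgrp F m := ⟨_, J_mem_int hy0 hym⟩
    let Y2 : Jgrp F n' := ⟨_, J_mem_int hy0 hyn⟩
    have e : p = (Y1, Y2) * ((p.1 * Y1⁻¹, 1) * (1, p.2 * Y2⁻¹)) := by
      ext1
      · simp
      · simp
    rw [e]
    refine mul_mem (Subgroup.subset_closure (Or.inr ⟨y, hy1, rfl, rfl⟩)) (mul_mem ?_ ?_)
    · refine ray_one hP' hQ' hP1' hQ1' hPp' hQp' hPQ' ?_
      rw [Subgroup.coe_mul, Units.val_mul, Subgroup.coe_inv, Units.val_inv_eq_inv_val, h1, sp_mul, sp_inv]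
      rfl
    · refine ray_two hP hQ hP1 hQ1 hPp hQp hPQ ?_
      rw [Subgroup.coe_mul, Units.val_mul, Subgroup.coe_inv, Units.val_inv_eq_inv_val, h2, sp_mul, sp_inv]
      rfl

end helpers2

section helpers3
variable {F}

lemma mm3 {I J K L : FI F} {x y z : F} (hx : x ∈ I) (hy : y ∈ J) (hz : z ∈ K)
    (h : I * J * K ≤ L) : x * y * z ∈ L :=
  mm (FractionalIdeal.mul_mem_mul hx hy) hz h

/-- The fractional ideal `b` in terms of `T = t d`. -/
def bT (T : FI F) (v : Fin 2 → F) : FI F := sp (v 0) + sp (v 1) * T⁻¹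

lemma bT_zero_mem (T : FI F) (v : Fin 2 → F) : v 0 ∈ bT T v :=
  sp_le.mp le_self_add

lemma bT_one_mem {T : FI F} (hT : T ≠ 0) (v : Fin 2 → F) : v 1 ∈ bT T v * T := by
  rw [← sp_le, bT, add_mul]
  have : sp (v 1) * T⁻¹ * T = sp (v 1) := by field_simp
  rw [this]
  exact le_add_self

lemma bT_le {T I : FI F} (hT : T ≠ 0) {v : Fin 2 → F} (h0 : v 0 ∈ I) (h1 : v 1 ∈ I * T) :
    bT T v ≤ I := by
  refine sup_le (sp_le.mpr h0) ?_
  refine le_cancel hT ?_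
  have : sp (v 1) * T⁻¹ * T = sp (v 1) := by field_simp
  rw [this]
  exact sp_le.mpr h1

lemma bT_ne {T : FI F} (hT : T ≠ 0) {v : Fin 2 → F} (hv : v ≠ 0) : bT T v ≠ 0 := by
  intro h
  apply hv
  have h0 := bT_zero_mem T v
  have h1 := bT_one_mem hT v
  rw [h] at h0
  rw [h, zero_mul] at h1
  have h0 := (FractionalIdeal.mem_zero_iff _).mp h0
  have h1 := (FractionalIdeal.mem_zero_iff _).mp h1
  ext i
  fin_cases i
  · exact h0
  · exact h1

lemma bT_smul (T : FI F) (s : F) (v : Fin 2 → F) : bT T (s • v) = sp s * bT T v := by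
  simp only [bT, Pi.smul_apply, smul_eq_mul, sp_mul]
  ring

/-- The congruence group in terms of `T = t d`. -/
def GT (T : FI F) (n : Ideal (𝓞 F)) : Set (Matrix (Fin 2) (Fin 2) F) :=
  {M | (∃ r : 𝓞 F, (r : F) = M 0 0) ∧ (∃ r : 𝓞 F, (r : F) = M 1 1) ∧
    M 1 0 ∈ T * (n : FI F) ∧
    M 0 1 ∈ T⁻¹ ∧
    (∃ u : (𝓞 F)ˣ, ((u : 𝓞 F) : F) = M.det) ∧
    TotPos F M.det ∧
    M 1 1 - 1 ∈ (n : FI F)}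

lemma Gamma_eq (tl : FI F) (n : Ideal (𝓞 F)) : Gamma F tl n = GT (tl * diffIdl F) n := rfl

lemma bA_eq (tl : FI F) (v : Fin 2 → F) : bA F tl v = bT (tl * diffIdl F) v := rfl

lemma mv0 (M : Matrix (Fin 2) (Fin 2) F) (v : Fin 2 → F) :
    Matrix.mulVec M v 0 = M 0 0 * v 0 + M 0 1 * v 1 := by
  simp [Matrix.mulVec, dotProduct, Fin.sum_univ_two]

lemma mv1 (M : Matrix (Fin 2) (Fin 2) F) (v : Fin 2 → F) :
    Matrix.mulVec M v 1 = M 1 0 * v 0 + M 1 1 * v 1 := by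
  simp [Matrix.mulVec, dotProduct, Fin.sum_univ_two]

lemma act_zero {T I : FI F} (hT : T ≠ 0) {M : Matrix (Fin 2) (Fin 2) F} (h00 : M 0 0 ∈ (1 : FI F))
    (h01 : M 0 1 ∈ T⁻¹) {v : Fin 2 → F} (h0 : v 0 ∈ I) (h1 : v 1 ∈ I * T) :
    Matrix.mulVec M v 0 ∈ I := by
  rw [mv0]
  refine fadd (mm h00 h0 (by simp)) (mm h01 h1 (le_of_eq (by field_simp)))

lemma act_one {T I : FI F} {M : Matrix (Fin 2) (Fin 2) F} (h10 : M 1 0 ∈ T)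
    (h11 : M 1 1 ∈ (1 : FI F)) {v : Fin 2 → F} (h0 : v 0 ∈ I) (h1 : v 1 ∈ I * T) :
    Matrix.mulVec M v 1 ∈ I * T := by
  rw [mv1]
  refine fadd (mm h10 h0 (le_of_eq (by ring))) (mm h11 h1 (by simp))

lemma GT_entries {T : FI F} {n : Ideal (𝓞 F)} {M : Matrix (Fin 2) (Fin 2) F}
    (hM : M ∈ GT T n) : M 0 0 ∈ (1 : FI F) ∧ M 0 1 ∈ T⁻¹ ∧ M 1 0 ∈ T ∧ M 1 1 ∈ (1 : FI F) := by
  obtain ⟨h1, h2, h3, h4, -⟩ := hM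
  refine ⟨mem_one_int.mpr h1, h4, ?_, mem_one_int.mpr h2⟩
  have : T * (n : FI F) ≤ T * 1 := mul_le_mul_right (idl_le_one n) T
  rw [mul_one] at this
  exact this h3

lemma bT_act_le {T : FI F} (hT : T ≠ 0) {M : Matrix (Fin 2) (Fin 2) F}
    (h00 : M 0 0 ∈ (1 : FI F)) (h01 : M 0 1 ∈ T⁻¹) (h10 : M 1 0 ∈ T)
    (h11 : M 1 1 ∈ (1 : FI F)) (v : Fin 2 → F) : bT T (Matrix.mulVec M v) ≤ bT T v :=
  bT_le hT (act_zero hT h00 h01 (bT_zero_mem T v) (bT_one_mem hT v))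
    (act_one h10 h11 (bT_zero_mem T v) (bT_one_mem hT v))

lemma sp_unit (u : (𝓞 F)ˣ) : sp ((u : 𝓞 F) : F) = 1 := by
  apply le_antisymm
  · rw [sp_le]; exact mem_one_int.mpr ⟨_, rfl⟩
  · rw [← spanSingleton_one, sp_le]
    have h := fint ((u⁻¹ : (𝓞 F)ˣ) : 𝓞 F) (mem_sp ((u : 𝓞 F) : F))
    rw [← c_mul, ← Units.val_mul, inv_mul_cancel, Units.val_one, c_one] at h
    exact h

lemma unit_of_sp {u : F} (h : sp u = 1) : ∃ r : (𝓞 F)ˣ, ((r : 𝓞 F) : F) = u := by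
  have hu : u ∈ (1 : FI F) := h ▸ mem_sp u
  have h0 : u ≠ 0 := by
    rintro rfl
    simp [sp] at h
  have hu' : u⁻¹ ∈ (1 : FI F) := by
    have : sp u⁻¹ = 1 := by rw [sp_inv, h, inv_one]
    exact this ▸ mem_sp u⁻¹
  obtain ⟨a, ha⟩ := mem_one_int.mp hu
  obtain ⟨b, hb⟩ := mem_one_int.mp hu'
  have hab : a * b = 1 := by
    apply RingOfIntegers.ext
    rw [c_mul, ha, hb, c_one, mul_inv_cancel₀ h0]
  exact ⟨⟨a, b, hab, by rw [mul_comm, hab]⟩, ha⟩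

lemma bT_act {T : FI F} (hT : T ≠ 0) {n : Ideal (𝓞 F)} {M : Matrix (Fin 2) (Fin 2) F}
    (hM : M ∈ GT T n) (v : Fin 2 → F) : bT T (Matrix.mulVec M v) = bT T v := by
  obtain ⟨h00, h01, h10, h11⟩ := GT_entries hM
  refine le_antisymm (bT_act_le hT h00 h01 h10 h11 v) ?_
  obtain ⟨u, hu⟩ := hM.2.2.2.2.1
  have h := bT_act_le hT (M := M.adjugate) (by rw [Matrix.adjugate_fin_two]; simpa using h11)
    (by rw [Matrix.adjugate_fin_two]; simpa using fneg h01)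
    (by rw [Matrix.adjugate_fin_two]; simpa using fneg h10)
    (by rw [Matrix.adjugate_fin_two]; simpa using h00) (Matrix.mulVec M v)
  rw [Matrix.mulVec_mulVec, Matrix.adjugate_mul, Matrix.smul_mulVec, Matrix.one_mulVec, bT_smul,
    ← hu, sp_unit, one_mul] at h
  exact h

lemma act_diff {T I : FI F} {n : Ideal (𝓞 F)} {M : Matrix (Fin 2) (Fin 2) F}
    (hM : M ∈ GT T n) {v : Fin 2 → F} (h0 : v 0 ∈ I) (h1 : v 1 ∈ I * T) :
    Matrix.mulVec M v 1 - v 1 ∈ I * (n * T) := by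
  rw [mv1]
  have : M 1 0 * v 0 + M 1 1 * v 1 - v 1 = M 1 0 * v 0 + (M 1 1 - 1) * v 1 := by ring
  rw [this]
  exact fadd (mm hM.2.2.1 h0 (le_of_eq (by ring))) (mm hM.2.2.2.2.2.2 h1 (le_of_eq (by ring)))

lemma cIdeal_coe {tl : FI F} (hT : tl * diffIdl F ≠ 0) {v : Fin 2 → F} (hv : v ≠ 0) :
    (cIdeal F tl v : FI F) =
      sp (v 1) * (tl * diffIdl F * bT (tl * diffIdl F) v)⁻¹ := by
  have hb := bT_ne hT hv
  have h : ∃ I : Ideal (𝓞 F), (I : FractionalIdeal (𝓞 F)⁰ F) =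
      spanSingleton (𝓞 F)⁰ (v 1) * (tl * diffIdl F * bA F tl v)⁻¹ := by
    rw [bA_eq, ← le_one_iff_exists_coeIdeal]
    refine le_cancel (mul_ne_zero hT hb) ?_
    rw [mul_assoc, inv_mul_cancel₀ (mul_ne_zero hT hb), mul_one, one_mul, mul_comm]
    exact sp_le.mpr (bT_one_mem hT v) |>.trans (le_of_eq (by ring))
  rw [cIdeal, dif_pos h]
  exact h.choose_spec

lemma mA_coe {tl : FI F} (hT : tl * diffIdl F ≠ 0) {v : Fin 2 → F} (hv : v ≠ 0)
    (n : Ideal (𝓞 F)) :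
    (mA F tl n v : FI F) * (tl * diffIdl F) =
      sp (v 1) * (bT (tl * diffIdl F) v)⁻¹ + n * (tl * diffIdl F) := by
  have hb := bT_ne hT hv
  have : (mA F tl n v : FI F) = cIdeal F tl v + n := coeIdeal_sup _ _
  rw [this, cIdeal_coe hT hv]
  clear this
  generalize tl * diffIdl F = T at *
  field_simp

lemma mA_eq_iff {tl : FI F} (hT : tl * diffIdl F ≠ 0) {v : Fin 2 → F} (hv : v ≠ 0)
    (n m : Ideal (𝓞 F)) : mA F tl n v = m ↔
      sp (v 1) * (bT (tl * diffIdl F) v)⁻¹ + n * (tl * diffIdl F) = m * (tl * diffIdl F) := by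
  rw [← mA_coe hT hv, mul_left_inj' hT, coeIdeal_inj]

lemma mA_inv {tl : FI F} (hT : tl * diffIdl F ≠ 0) {v w : Fin 2 → F} (hv : v ≠ 0) (hw : w ≠ 0)
    (n : Ideal (𝓞 F)) {γ : Matrix (Fin 2) (Fin 2) F} (hγ : γ ∈ Gamma F tl n) {s : F} (hs : s ≠ 0)
    (h : Matrix.mulVec γ v = s • w) : mA F tl n w = mA F tl n v := by
  rw [Gamma_eq] at hγ
  rw [mA_eq_iff hT hw, mA_coe hT hv]
  set T := tl * diffIdl F
  have hb := bT_ne hT hv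
  have e1 : bT T v = sp s * bT T w := by rw [← bT_smul, ← h, bT_act hT hγ]
  have hs' := sp_ne hs
  have e2 : sp (w 1) * (bT T w)⁻¹ = sp (Matrix.mulVec γ v 1) * (bT T v)⁻¹ := by
    rw [h, e1, Pi.smul_apply, smul_eq_mul, sp_mul]
    field_simp
  rw [e2]
  have hd := act_diff hγ (bT_zero_mem T v) (bT_one_mem hT v)
  set c := Matrix.mulVec γ v 1
  have hd' : sp (c - v 1) * (bT T v)⁻¹ ≤ n * T := by
    refine le_cancel hb ?_
    rw [inv_mul_cancel_right₀ hb]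
    exact (sp_le.mpr hd).trans (le_of_eq (by ring))
  apply le_antisymm
  · refine sup_le ?_ le_add_self
    have : sp c ≤ sp (v 1) + sp (c - v 1) := by
      rw [sp_le]
      exact (mem_add _ _ _).mpr ⟨_, mem_sp _, _, mem_sp _, by ring⟩
    calc sp c * (bT T v)⁻¹ ≤ (sp (v 1) + sp (c - v 1)) * (bT T v)⁻¹ := mul_le_mul_left this _
      _ = sp (v 1) * (bT T v)⁻¹ + sp (c - v 1) * (bT T v)⁻¹ := by ring
      _ ≤ _ := add_le_add le_rfl hd'
  · refine sup_le ?_ le_add_self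
    have : sp (v 1) ≤ sp c + sp (c - v 1) := by
      rw [sp_le]
      exact (mem_add _ _ _).mpr ⟨_, mem_sp _, _, fneg (mem_sp (c - v 1)), by ring⟩
    calc sp (v 1) * (bT T v)⁻¹ ≤ (sp c + sp (c - v 1)) * (bT T v)⁻¹ := mul_le_mul_left this _
      _ = sp c * (bT T v)⁻¹ + sp (c - v 1) * (bT T v)⁻¹ := by ring
      _ ≤ _ := add_le_add le_rfl hd'

end helpers3

section helpers4
variable {F}

/-- Adapted data: `A v ⊕ C w = O ⊕ T`, with normalized level structure. -/
structure Adm (T : FI F) (m n : Ideal (𝓞 F)) (g τ : F) (C A : Idl F) (v w : Fin 2 → F) :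
    Prop where
  a : v 0 ∈ (A : FI F)⁻¹
  c : v 1 ∈ (A : FI F)⁻¹ * (m * T)
  x : w 0 ∈ (C : FI F)⁻¹
  y : w 1 ∈ (C : FI F)⁻¹ * T
  det : (A : FI F) * C * sp (v 0 * w 1 - v 1 * w 0) = T
  pos : TotPos F (v 0 * w 1 - v 1 * w 0)
  A1 : (1 : F) ∈ (A : FI F)
  C1 : (1 : F) ∈ (C : FI F)
  cg : v 1 - g ∈ n * T
  yt : w 1 - τ ∈ m * T

lemma one_le_of {I : FI F} (h : (1 : F) ∈ I) : 1 ≤ I := by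
  rwa [← sp_le, sp, spanSingleton_one] at h

lemma inv_le_one_of {A : Idl F} (h : (1 : F) ∈ (A : FI F)) : (A : FI F)⁻¹ ≤ 1 := by
  refine le_cancel A.ne_zero ?_
  rw [inv_mul_cancel₀ A.ne_zero, one_mul]
  exact one_le_of h

lemma mul_le_of_le_one {I J : FI F} (h : I ≤ 1) : I * J ≤ J := by
  have := mul_le_mul_left h J
  rwa [one_mul] at this

lemma Adm.delta_ne {T : FI F} (hT : T ≠ 0) {m n : Ideal (𝓞 F)} {g τ : F} {C A : Idl F}
    {v w : Fin 2 → F} (h : Adm T m n g τ C A v w) : v 0 * w 1 - v 1 * w 0 ≠ 0 := by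
  intro h0
  apply hT
  rw [← h.det, h0]
  simp [sp]

lemma Adm.v_ne {T : FI F} (hT : T ≠ 0) {m n : Ideal (𝓞 F)} {g τ : F} {C A : Idl F}
    {v w : Fin 2 → F} (h : Adm T m n g τ C A v w) : v ≠ 0 := by
  rintro rfl
  apply h.delta_ne hT
  simp

lemma Adm.cT {T : FI F} {m n : Ideal (𝓞 F)} {g τ : F} {C A : Idl F}
    {v w : Fin 2 → F} (h : Adm T m n g τ C A v w) : v 1 ∈ (A : FI F)⁻¹ * T :=
  (mul_le_mul_right (mul_le_of_le_one (idl_le_one m)) _) h.c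

lemma Adm.b {T : FI F} (hT : T ≠ 0) {m n : Ideal (𝓞 F)} {g τ : F} {C A : Idl F}
    {v w : Fin 2 → F} (h : Adm T m n g τ C A v w) : bT T v = (A : FI F)⁻¹ := by
  have hA := A.ne_zero
  have hC := C.ne_zero
  refine le_antisymm (bT_le hT h.a h.cT) ?_
  have hδ : sp (v 0 * w 1 - v 1 * w 0) ≤ bT T v * ((C : FI F)⁻¹ * T) := by
    rw [sp_le]
    exact fsub (mm (bT_zero_mem T v) h.y le_rfl)
      (mm (bT_one_mem hT v) h.x (le_of_eq (by ring)))
  have hd := h.det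
  refine le_cancel (K := (C : FI F)⁻¹ * T) (mul_ne_zero (inv_ne_zero hC) hT) ?_
  refine le_trans (le_of_eq ?_) hδ
  conv_lhs => rw [← hd]
  field_simp

lemma Adm.K {T : FI F} (hT : T ≠ 0) {m n n' : Ideal (𝓞 F)} (hn : m * n' = n) {g τ : F}
    (hg : sp g + n' * (m * T) = m * T) {C A : Idl F}
    {v w : Fin 2 → F} (h : Adm T m n g τ C A v w) :
    sp (v 1) * (A : FI F) + n * T = m * T := by
  have hA := A.ne_zero
  have en : (n : FI F) * T = n' * (m * T) := by rw [← hn, coeIdeal_mul]; ring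
  apply le_antisymm
  · refine sup_le ?_ ?_
    · have := mul_le_mul_left (sp_le.mpr h.c) (A : FI F)
      refine this.trans (le_of_eq ?_)
      field_simp
    · rw [en]; exact mul_le_of_le_one (idl_le_one _)
  · conv_lhs => rw [← hg]
    rw [← en]
    refine sup_le ?_ le_add_self
    rw [sp_le]
    refine (mem_add _ _ _).mpr ⟨v 1 * 1, mm (mem_sp _) h.A1 le_rfl, -(v 1 - g), fneg h.cg, by ring⟩

lemma Adm.JA {T : FI F} (hT : T ≠ 0) {m n n' : Ideal (𝓞 F)} (hm : m ≠ ⊥) (hn : m * n' = n)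
    {g τ : F} (hg : sp g + n' * (m * T) = m * T) {C A : Idl F}
    {v w : Fin 2 → F} (h : Adm T m n g τ C A v w) : A ∈ Jgrp F n' := by
  have en : (n : FI F) * T = n' * (m * T) := by rw [← hn, coeIdeal_mul]; ring
  refine J_of h.A1 (le_cancel (mul_ne_zero (idl_ne hm) hT) ?_)
  rw [one_mul, add_mul]
  conv_lhs => rw [← hg]
  refine sup_le ?_ le_add_self
  rw [sp_le]
  exact (mem_add _ _ _).mpr ⟨v 1, h.c, -(v 1 - g), fneg (en ▸ h.cg), by ring⟩

lemma Adm.JC {T : FI F} (hT : T ≠ 0) {m n : Ideal (𝓞 F)}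
    {g τ : F} (hτ : sp τ + m * T = T) {C A : Idl F}
    {v w : Fin 2 → F} (h : Adm T m n g τ C A v w) : C ∈ Jgrp F m := by
  refine J_of h.C1 (le_cancel hT ?_)
  rw [one_mul, add_mul]
  conv_lhs => rw [← hτ]
  refine sup_le ?_ le_add_self
  rw [sp_le]
  exact (mem_add _ _ _).mpr ⟨w 1, h.y, -(w 1 - τ), fneg h.yt, by ring⟩

lemma RR_of {I : FI F} (hI : I ≠ 0) {c : Ideal (𝓞 F)} (hc : c ≠ ⊥) {g : F}
    (hg : sp g + c * I = I) {A : Idl F} (hA : A ∈ Jgrp F c) {s c' : F} (hs : s ∈ (A : FI F))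
    (hs0 : s ≠ 0) (h1 : c' - g ∈ c * I) (h2 : s * c' - g ∈ c * I) : RR c s := by
  obtain ⟨q, hq0, -, hq1, hqA⟩ := J_mem_pos hc (inv_mem hA)
  rw [Units.val_inv_eq_inv_val] at hqA
  have hp : s * q ∈ (1 : FI F) := mm hs hqA (le_of_eq (mul_inv_cancel₀ A.ne_zero))
  obtain ⟨p, hp⟩ := mem_one_int.mp hp
  have hp0 : p ≠ 0 := by
    rintro rfl
    have : s * (q : F) = 0 := hp.symm
    exact (mul_ne_zero hs0 (int_ne hq0)) this
  refine ⟨p, q, hp0, hq0, ?_, hq1, hp.symm⟩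
  have hgI : g ∈ I := by
    rw [← sp_le]
    conv_rhs => rw [← hg]
    exact le_self_add
  have hq1' : (q : F) - 1 ∈ (c : FI F) := by
    have := mem_idl (F := F).mpr hq1
    rwa [c_sub, c_one] at this
  have key : ((p : F) - 1) * g ∈ c * I := by
    have e : ((p : F) - 1) * g = -((p : F) * (c' - g)) + (q : F) * (s * c' - g) + ((q : F) - 1) * g := by
      rw [hp]; ring
    rw [e]
    exact fadd (fadd (fneg (fint p h1)) (fint q h2)) (mm hq1' hgI le_rfl)
  have h3 : sp ((p : F) - 1) ≤ c := by
    refine le_cancel hI ?_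
    conv_lhs => rw [← hg]
    rw [mul_add, ← sp_mul]
    refine sup_le (sp_le.mpr key) ?_
    refine mul_le_of_le_one (sp_le.mpr ?_)
    exact mem_one_int.mpr ⟨p - 1, by rw [c_sub, c_one]⟩
  rw [sp_le, ← c_one, ← c_sub] at h3
  exact mem_idl.mp h3

lemma RR_use {I : FI F} {c : Ideal (𝓞 F)} (hc : c ≠ ⊥) {g : F}
    (hgI : g ∈ I) {A : Idl F} (hA : A ∈ Jgrp F c) {s d d' : F}
    (h1 : d - g ∈ c * I) (h1' : d' - g ∈ c * I) (hd : d ∈ (A : FI F)⁻¹ * I)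
    (hd' : s * d' ∈ (A : FI F)⁻¹ * I) (hs : RR c s) : s * d' - d ∈ (A : FI F)⁻¹ * (c * I) := by
  obtain ⟨p, q, hp0, hq0, hp1, hq1, hpq⟩ := hs
  obtain ⟨β, hβ0, -, hβ1, hβA⟩ := J_mem_pos hc (inv_mem hA)
  rw [Units.val_inv_eq_inv_val] at hβA
  have hcI : (c : FI F) * I ≤ I := mul_le_of_le_one (idl_le_one c)
  have hdI : d ∈ I := by
    have := fadd (hcI h1) hgI
    simpa using this
  have hdI' : d' ∈ I := by
    have := fadd (hcI h1') hgI
    simpa using this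
  have up : ∀ x : 𝓞 F, x - 1 ∈ c → (x : F) - 1 ∈ (c : FI F) := by
    intro x hx
    have := mem_idl (F := F).mpr hx
    rwa [c_sub, c_one] at this
  have hy : s * d' - d ∈ (A : FI F)⁻¹ * I := fsub hd' hd
  have e1 : (p : F) * d' - q * d ∈ (c : FI F) * I := by
    have : (p : F) * d' - q * d = ((p : F) - 1) * d' - ((q : F) - 1) * d + ((d' - g) - (d - g)) := by ring
    rw [this]
    exact fadd (fsub (mm (up p hp1) hdI' le_rfl) (mm (up q hq1) hdI le_rfl)) (fsub h1' h1)
  have e : s * d' - d = β * ((p : F) * d' - q * d) - (((q * β : 𝓞 F) : F) - 1) * (s * d' - d) := by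
    rw [c_mul, ← hpq]; ring
  rw [e]
  refine fsub (mm hβA e1 le_rfl) (mm (up _ (mul_cong_one hq1 hβ1)) hy (le_of_eq (by ring)))

set_option maxHeartbeats 1000000 in
lemma adm_forward {T : FI F} (hT : T ≠ 0) {m n n' : Ideal (𝓞 F)} (hm : m ≠ ⊥) (hn' : n' ≠ ⊥)
    (hn : m * n' = n) {g τ : F} (hg : sp g + n' * (m * T) = m * T) (hτ : sp τ + m * T = T)
    {C A C' A' : Idl F} {v w v' w' : Fin 2 → F} (h : Adm T m n g τ C A v w)
    (h' : Adm T m n g τ C' A' v' w') {γ : Matrix (Fin 2) (Fin 2) F} (hγ : γ ∈ GT T n)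
    {s : F} (hs : s ≠ 0) (hv : Matrix.mulVec γ v = s • v') :
    ∃ x z : F, RR n' x ∧ RR m z ∧ TotPos F (x * z) ∧
      (C' : FI F) = sp z * C ∧ (A' : FI F) = sp x * A := by
  have en : (n : FI F) * T = n' * (m * T) := by rw [← hn, coeIdeal_mul]; ring
  have hnm : (n : FI F) * T ≤ m * T := by rw [en]; exact mul_le_of_le_one (idl_le_one _)
  have hA := A.ne_zero
  have hC := C.ne_zero
  have hA' := A'.ne_zero
  have hC' := C'.ne_zero
  have hsp := sp_ne hs
  have hδ := h.delta_ne hT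
  have hδ' := h'.delta_ne hT
  have hdet := h.det
  have hdet' := h'.det
  have hpos := h.pos
  have hpos' := h'.pos
  set δ := v 0 * w 1 - v 1 * w 0 with hδd
  set δ' := v' 0 * w' 1 - v' 1 * w' 0 with hδd'
  have hspδ := sp_ne hδ
  have hspδ' := sp_ne hδ'
  obtain ⟨u, hu⟩ := hγ.2.2.2.2.1
  have hspu : sp γ.det = 1 := by rw [← hu, sp_unit]
  have hu0 : γ.det ≠ 0 := by
    intro h0; rw [h0] at hspu; simp [sp] at hspu
  have eA : (A' : FI F) = sp s * A := by
    have h1 := bT_act hT hγ v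
    rw [hv, bT_smul, h.b hT, h'.b hT] at h1
    field_simp at h1
    rw [h1]
  set z := γ.det * δ / (s * δ') with hz
  have hz0 : z ≠ 0 := div_ne_zero (mul_ne_zero hu0 hδ) (mul_ne_zero hs hδ')
  have eC : (C' : FI F) = sp z * C := by
    have e1 : sp z = sp δ * (sp s)⁻¹ * (sp δ')⁻¹ := by
      rw [hz, div_eq_mul_inv, mul_inv, sp_mul, sp_mul, hspu, sp_mul, sp_inv, sp_inv]; ring
    have e2 := hdet.trans hdet'.symm
    rw [eA] at e2
    rw [e1]
    have e3 : (A : FI F) * (C * sp δ) = A * (sp s * C' * sp δ') := by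
      rw [← mul_assoc, e2]; ring
    have e4 := mul_left_cancel₀ hA e3
    field_simp
    rw [mul_comm (sp δ), e4]; ring
  have hA1' := inv_le_one_of h.A1
  have hC1' := inv_le_one_of h.C1
  have one_mul_mem : ∀ {I : FI F} {x : F}, x ∈ I * T → I ≤ 1 → x ∈ 1 * T := by
    intro I x hx hI
    rw [one_mul]; exact mul_le_of_le_one hI hx
  have d1 := act_diff hγ (I := 1) (hA1' h.a) (one_mul_mem h.cT hA1')
  have d2 := act_diff hγ (I := 1) (hC1' h.x) (one_mul_mem h.y hC1')
  have W0 := act_zero hT (GT_entries hγ).1 (GT_entries hγ).2.1 (I := 1) (hC1' h.x)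
    (one_mul_mem h.y hC1')
  have W1 := act_one (GT_entries hγ).2.2.1 (GT_entries hγ).2.2.2 (I := 1) (hC1' h.x)
    (one_mul_mem h.y hC1')
  rw [one_mul] at d1 d2 W1
  have hx : RR n' s := by
    have hcg' : v' 1 - g ∈ n' * (m * T) := by rw [← en]; exact h'.cg
    refine RR_of (I := (m : FI F) * T) (mul_ne_zero (idl_ne hm) hT) hn' hg (h'.JA hT hm hn hg)
      (c' := v' 1) ?_ hs hcg' ?_
    · rw [eA]; simpa using mm (mem_sp s) h.A1 le_rfl
    · have : s * v' 1 - g = (Matrix.mulVec γ v 1 - v 1) + (v 1 - g) := by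
        rw [hv]; simp
      rw [this, ← en]
      exact fadd d1 h.cg
  refine ⟨s, z, hx, ?_, ?_, eC, eA⟩
  · refine RR_of (I := T) hT hm hτ (h'.JC hT hτ) (c' := w' 1) ?_ hz0 h'.yt ?_
    · rw [eC]; simpa using mm (mem_sp z) h.C1 le_rfl
    · set W := Matrix.mulVec γ w with hW
      set k := (W 0 * w' 1 - W 1 * w' 0) * δ'⁻¹ with hk
      have hkA : k ∈ (A' : FI F) := by
        have h1 : W 0 * w' 1 - W 1 * w' 0 ∈ (C' : FI F)⁻¹ * T :=
          fsub (mm W0 h'.y (by simp)) (mm W1 h'.x (le_of_eq (by ring)))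
        refine mm h1 (mem_sp δ'⁻¹) (le_of_eq ?_)
        rw [sp_inv]
        conv_lhs => rw [← hdet']
        field_simp
      have hkv : k * v' 1 ∈ (m : FI F) * T := mm hkA h'.c (le_of_eq (by field_simp))
      have hd : s * (v' 0 * W 1 - v' 1 * W 0) = γ.det * δ := by
        have a0 : s * v' 0 = γ 0 0 * v 0 + γ 0 1 * v 1 := by
          rw [← mv0, hv]; simp
        have a1 : s * v' 1 = γ 1 0 * v 0 + γ 1 1 * v 1 := by
          rw [← mv1, hv]; simp
        rw [Matrix.det_fin_two, hδd, hW, mv0, mv1]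
        linear_combination (γ 1 0 * w 0 + γ 1 1 * w 1) * a0 - (γ 0 0 * w 0 + γ 0 1 * w 1) * a1
      have e : z * w' 1 + k * v' 1 = W 1 := by
        rw [hz, hk, ← hd]
        field_simp
        rw [hδd']; ring
      have : z * w' 1 - τ = (W 1 - w 1) + (w 1 - τ) - k * v' 1 := by rw [← e]; ring
      rw [this]
      exact fsub (fadd (hnm d2) h.yt) hkv
  · have : s * z = γ.det * δ * δ'⁻¹ := by rw [hz]; field_simp
    rw [this]
    exact (hγ.2.2.2.2.2.1.mul' hpos).mul' hpos'.inv'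

end helpers4

section helpers5
variable {F}

set_option maxHeartbeats 1000000 in
lemma adm_backward {T : FI F} (hT : T ≠ 0) {m n n' : Ideal (𝓞 F)} (hm : m ≠ ⊥) (hn' : n' ≠ ⊥)
    (hn : m * n' = n) {g τ : F} (hg : sp g + n' * (m * T) = m * T) (hτ : sp τ + m * T = T)
    {C A C' A' : Idl F} {v w v' w' : Fin 2 → F} (h : Adm T m n g τ C A v w)
    (h' : Adm T m n g τ C' A' v' w') {x z : F} (hx : RR n' x) (hz : RR m z)
    (hxz : TotPos F (x * z)) (eC : (C' : FI F) = sp z * C) (eA : (A' : FI F) = sp x * A) :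
    ∃ γ ∈ GT T n, Matrix.mulVec γ v = x • v' := by
  have en : (n : FI F) * T = n' * (m * T) := by rw [← hn, coeIdeal_mul]; ring
  have hA := A.ne_zero
  have hC := C.ne_zero
  have hx0 := hx.ne_zero
  have hz0 := hz.ne_zero
  have hspx := sp_ne hx0
  have hspz := sp_ne hz0
  have hK' := h'.K hT hn hg
  have hδ := h.delta_ne hT
  have hδ' := h'.delta_ne hT
  have hdet := h.det
  have hdet' := h'.det
  have hpos := h.pos
  have hpos' := h'.pos
  have hgI : g ∈ (m : FI F) * T := by
    rw [← sp_le]; conv_rhs => rw [← hg]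
    exact le_self_add
  have hτI : τ ∈ T := by
    rw [← sp_le]; conv_rhs => rw [← hτ]
    exact le_self_add
  have hcg : v 1 - g ∈ n' * (m * T) := by rw [← en]; exact h.cg
  have hcg' : v' 1 - g ∈ n' * (m * T) := by rw [← en]; exact h'.cg
  have p1 : x * v' 1 - v 1 ∈ (A : FI F)⁻¹ * (n * T) := by
    rw [en]
    refine RR_use (I := (m : FI F) * T) hn' hgI (h.JA hT hm hn hg) hcg hcg' h.c ?_ hx
    refine mm (mem_sp x) h'.c (le_of_eq ?_)
    rw [eA]; field_simp
  have p2 : z * w' 1 - w 1 ∈ (C : FI F)⁻¹ * (m * T) := by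
    refine RR_use (I := T) hm hτI (h.JC hT hτ) h.yt h'.yt h.y ?_ hz
    refine mm (mem_sp z) h'.y (le_of_eq ?_)
    rw [eC]; field_simp
  have p3 : -(z * w' 1 - w 1) ∈ sp (v' 1) * ((A' : FI F) * (C : FI F)⁻¹) + (C : FI F)⁻¹ * (n * T) := by
    have : sp (v' 1) * ((A' : FI F) * (C : FI F)⁻¹) + (C : FI F)⁻¹ * (n * T)
      = (C : FI F)⁻¹ * (m * T) := by rw [← hK']; ring
    rw [this]; exact fneg p2
  obtain ⟨k1, hk1, e1, he1, hke⟩ := (mem_add _ _ _).mp p3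
  obtain ⟨k, hk, rfl⟩ := mem_sp_mul.mp hk1
  have p4 : z * w' 1 + k * v' 1 - w 1 ∈ (C : FI F)⁻¹ * (n * T) := by
    have : z * w' 1 + k * v' 1 - w 1 = - e1 := by linear_combination hke
    rw [this]; exact fneg he1
  have p5 : x * v' 0 ∈ (A : FI F)⁻¹ := by
    refine mm (mem_sp x) h'.a (le_of_eq ?_)
    rw [eA]; field_simp
  have p6 : z * w' 0 + k * v' 0 ∈ (C : FI F)⁻¹ := by
    refine fadd (mm (mem_sp z) h'.x (le_of_eq ?_)) (mm hk h'.a (le_of_eq ?_))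
    · rw [eC]; field_simp
    · rw [eA]; field_simp
  clear p2 p3 hk1 hke he1
  set V0 := x * v' 0 with hV0
  set V1 := x * v' 1 with hV1
  set W0 := z * w' 0 + k * v' 0 with hW0
  set W1 := z * w' 1 + k * v' 1 with hW1
  have hdd : V0 * W1 - V1 * W0 = x * z * (v' 0 * w' 1 - v' 1 * w' 0) := by
    rw [hV0, hV1, hW0, hW1]; ring
  set δ' := v' 0 * w' 1 - v' 1 * w' 0 with hδd'
  have ha := h.a
  have hc := h.cT
  have hwx := h.x
  have hwy := h.y
  have hspδ := sp_ne hδ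
  have hspδ' := sp_ne hδ'
  set δ := v 0 * w 1 - v 1 * w 0 with hδd
  have eδ : sp δ⁻¹ = (A : FI F) * C * T⁻¹ := by
    rw [sp_inv, ← hdet]; field_simp
  have hnT : (n : FI F) * T ≤ T := mul_le_of_le_one (idl_le_one _)
  have p7 : V1 ∈ (A : FI F)⁻¹ * T := by
    have := fadd (mul_le_mul_right hnT _ p1) hc
    simpa using this
  have p8 : W1 ∈ (C : FI F)⁻¹ * T := by
    have := fadd (mul_le_mul_right hnT _ p4) hwy
    simpa using this
  let γ : Matrix (Fin 2) (Fin 2) F := !![(V0 * w 1 - W0 * v 1) * δ⁻¹, (W0 * v 0 - V0 * w 0) * δ⁻¹;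
    (V1 * w 1 - W1 * v 1) * δ⁻¹, (W1 * v 0 - V1 * w 0) * δ⁻¹]
  have g00 : γ 0 0 = (V0 * w 1 - W0 * v 1) * δ⁻¹ := rfl
  have g01 : γ 0 1 = (W0 * v 0 - V0 * w 0) * δ⁻¹ := rfl
  have g10 : γ 1 0 = (V1 * w 1 - W1 * v 1) * δ⁻¹ := rfl
  have g11 : γ 1 1 = (W1 * v 0 - V1 * w 0) * δ⁻¹ := rfl
  have gdet : γ.det = x * z * δ' * δ⁻¹ := by
    rw [Matrix.det_fin_two, g00, g01, g10, g11, ← hdd]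
    field_simp
    rw [hδd]; ring
  have q00 : γ 0 0 ∈ (1 : FI F) := by
    rw [g00]
    refine mm (I := (A : FI F)⁻¹ * ((C : FI F)⁻¹ * T)) (fsub (mm p5 hwy le_rfl) (mm p6 hc (le_of_eq (by ring)))) (mem_sp _) (le_of_eq ?_)
    rw [eδ]; field_simp
  have q01 : γ 0 1 ∈ T⁻¹ := by
    rw [g01]
    refine mm (I := (A : FI F)⁻¹ * (C : FI F)⁻¹) (fsub (mm p6 ha (le_of_eq (by ring))) (mm p5 hwx le_rfl)) (mem_sp _) (le_of_eq ?_)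
    rw [eδ]; field_simp
  have q10 : γ 1 0 ∈ T * (n : FI F) := by
    have e : V1 * w 1 - W1 * v 1 = (V1 - v 1) * w 1 - (W1 - w 1) * v 1 := by ring
    rw [g10, e]
    refine mm (I := (A : FI F)⁻¹ * (C : FI F)⁻¹ * T * ((n : FI F) * T)) (fsub (mm p1 hwy (le_of_eq (by ring))) (mm p4 hc (le_of_eq (by ring)))) (mem_sp _) (le_of_eq ?_)
    rw [eδ]; field_simp
  have q11 : γ 1 1 - 1 ∈ (n : FI F) := by
    have e : γ 1 1 - 1 = ((W1 - w 1) * v 0 - (V1 - v 1) * w 0) * δ⁻¹ := by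
      rw [g11]; field_simp; rw [hδd]; ring
    rw [e]
    refine mm (I := (A : FI F)⁻¹ * (C : FI F)⁻¹ * ((n : FI F) * T)) (fsub (mm p4 ha (le_of_eq (by ring))) (mm p1 hwx (le_of_eq (by ring)))) (mem_sp _) (le_of_eq ?_)
    rw [eδ]; field_simp
  refine ⟨γ, ⟨mem_one_int.mp q00, ?_, q10, q01, ?_, ?_, q11⟩, ?_⟩
  · apply mem_one_int.mp
    have := fadd (idl_le_one n q11) (one_mem_one (𝓞 F)⁰)
    simpa using this
  · apply unit_of_sp
    rw [gdet, sp_mul, sp_mul, sp_mul, eδ]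
    have e := hdet'
    rw [eA, eC] at e
    have e2 : sp x * sp z * sp δ' * ((A : FI F) * C * T⁻¹) = (sp x * A * (sp z * C) * sp δ') * T⁻¹ := by ring
    rw [e2, e, mul_inv_cancel₀ hT]
  · rw [gdet]
    exact (hxz.mul' hpos').mul' hpos.inv'
  · ext i
    fin_cases i
    · show Matrix.mulVec γ v 0 = x * v' 0
      rw [mv0, g00, g01, ← hV0]
      field_simp
      rw [hδd]; ring
    · show Matrix.mulVec γ v 1 = x * v' 1
      rw [mv1, g10, g11, ← hV1]
      field_simp
      rw [hδd]; ring

set_option maxHeartbeats 1000000 in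
lemma exists_adm {T : FI F} (hT : T ≠ 0) {m n n' : Ideal (𝓞 F)} (hm : m ≠ ⊥) (hn' : n' ≠ ⊥)
    (hn : m * n' = n) {g τ : F} (hg : sp g + n' * (m * T) = m * T) (hτ : sp τ + m * T = T)
    {v : Fin 2 → F} (hv : v ≠ 0) (hK : sp (v 1) * (bT T v)⁻¹ + n * T = m * T) :
    ∃ l : F, l ≠ 0 ∧ ∃ (C A : Idl F) (w : Fin 2 → F), Adm T m n g τ C A (l • v) w := by
  have hb := bT_ne hT hv
  have hn0 : (n : FI F) ≠ 0 := by
    rw [← hn, coeIdeal_mul]; exact mul_ne_zero (idl_ne hm) (idl_ne hn')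
  have hgI : g ∈ sp (v 1) * (bT T v)⁻¹ + n * T := by
    rw [hK, ← sp_le]; conv_rhs => rw [← hg]
    exact le_self_add
  have hτI : τ ∈ T := by
    rw [← sp_le]; conv_rhs => rw [← hτ]
    exact le_self_add
  obtain ⟨k1, hk1, e1, he1, hke⟩ := (mem_add _ _ _).mp hgI
  obtain ⟨l0, hl0, rfl⟩ := mem_sp_mul.mp hk1
  obtain ⟨l, hl, hlne, -⟩ := exists_shift l0 (I := (n : FI F) * (bT T v)⁻¹) (mul_ne_zero hn0 (inv_ne_zero hb))
  have hlb : l ∈ (bT T v)⁻¹ := by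
    have := fadd (mul_le_of_le_one (idl_le_one n) hl) hl0
    simpa using this
  have hspl := sp_ne hlne
  have hv1 := bT_one_mem hT v
  have hbl : bT T (l • v) = sp l * bT T v := bT_smul T l v
  set b := bT T v with hbdef
  let A : Idl F := Units.mk0 ((sp l)⁻¹ * b⁻¹) (mul_ne_zero (inv_ne_zero hspl) (inv_ne_zero hb))
  have hAc : (A : FI F) = (sp l)⁻¹ * b⁻¹ := rfl
  have hAi : (A : FI F)⁻¹ = bT T (l • v) := by rw [hbl, hAc, mul_inv, inv_inv, inv_inv]
  have hA := A.ne_zero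
  have ha : (l • v) 0 ∈ (A : FI F)⁻¹ := by rw [hAi]; exact bT_zero_mem _ _
  have hcT : (l • v) 1 ∈ (A : FI F)⁻¹ * T := by rw [hAi]; exact bT_one_mem hT _
  have hA1 : (1 : F) ∈ (A : FI F) := by
    have : l⁻¹ * l ∈ (A : FI F) := by
      refine mm (mem_sp l⁻¹) hlb (le_of_eq ?_)
      rw [sp_inv, hAc]
    rwa [inv_mul_cancel₀ hlne] at this
  have hc : (l • v) 1 ∈ (A : FI F)⁻¹ * (m * T) := by
    rw [hAi, hbl, ← hK]
    refine mul_le_mul_right (le_self_add : _ ≤ sp (v 1) * b⁻¹ + n * T) (sp l * b) ?_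
    refine mm (mem_sp l) (mem_sp (v 1)) (le_of_eq ?_)
    field_simp
  have hcg : (l • v) 1 - g ∈ n * T := by
    have : (l • v) 1 - g = (l - l0) * v 1 - e1 := by
      rw [← hke, Pi.smul_apply, smul_eq_mul]; ring
    rw [this]
    refine fsub (mm hl hv1 (le_of_eq ?_)) he1
    field_simp
  have hone : (1 : F) ∈ sp ((l • v) 0) * (A : FI F) + sp ((l • v) 1) * (T⁻¹ * A) := by
    have e : sp ((l • v) 0) * (A : FI F) + sp ((l • v) 1) * (T⁻¹ * A) = 1 := by
      rw [← inv_mul_cancel₀ hA, hAi, bT]; ring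
    rw [e]; exact one_mem_one _
  obtain ⟨k2, hk2, e2, he2, h12⟩ := (mem_add _ _ _).mp hone
  obtain ⟨y, hy, rfl⟩ := mem_sp_mul.mp hk2
  obtain ⟨x', hx', rfl⟩ := mem_sp_mul.mp he2
  set V0 := (l • v) 0 with hV0
  set V1 := (l • v) 1 with hV1
  clear hk1 hke hk2 he2 hgI
  obtain ⟨r, hr, hrne, hrpos⟩ := exists_shift (V0 * τ) (I := (m : FI F) * (T * (A : FI F)⁻¹))
    (mul_ne_zero (idl_ne hm) (mul_ne_zero hT (inv_ne_zero hA)))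
  have hrC : r ∈ T * (A : FI F)⁻¹ := by
    have := fadd (mul_le_of_le_one (idl_le_one m) hr) (mm ha hτI (le_of_eq (mul_comm _ T)))
    simpa using this
  have hspr := sp_ne hrne
  let C : Idl F := Units.mk0 ((sp r)⁻¹ * (T * (A : FI F)⁻¹))
    (mul_ne_zero (inv_ne_zero hspr) (mul_ne_zero hT (inv_ne_zero hA)))
  have hCc : (C : FI F) = (sp r)⁻¹ * (T * (A : FI F)⁻¹) := rfl
  have hd : V0 * (r * y) - V1 * (-(r * x')) = r := by linear_combination r * h12
  refine ⟨l, hlne, C, A, ![-(r * x'), r * y], ?_⟩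
  constructor
  · exact ha
  · exact hc
  · show -(r * x') ∈ _
    refine fneg (mm (mem_sp r) hx' (le_of_eq ?_))
    rw [hCc]; field_simp
  · show r * y ∈ _
    refine (mm (mem_sp r) hy (le_of_eq ?_))
    rw [hCc]; field_simp
  · show (A : FI F) * C * sp (V0 * (r * y) - V1 * (-(r * x'))) = T
    rw [hd, hCc]; field_simp
  · show TotPos F (V0 * (r * y) - V1 * (-(r * x')))
    rw [hd]; exact hrpos
  · exact hA1
  · have : r⁻¹ * r ∈ (C : FI F) := by
      refine mm (mem_sp r⁻¹) hrC (le_of_eq ?_)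
      rw [sp_inv, hCc]
    rwa [inv_mul_cancel₀ hrne] at this
  · exact hcg
  · show r * y - τ ∈ _
    have : r * y - τ = (r - V0 * τ) * y - τ * x' * V1 := by linear_combination τ * h12
    rw [this]
    refine fsub (mm hr hy (le_of_eq ?_)) (mm3 hτI hx' hc (le_of_eq ?_))
    · field_simp
    · field_simp

set_option maxHeartbeats 1000000 in
lemma exists_adm_of {T : FI F} (hT : T ≠ 0) {m n n' : Ideal (𝓞 F)} (hm : m ≠ ⊥) (hn' : n' ≠ ⊥)
    (hn : m * n' = n) {g τ : F} (hg : sp g + n' * (m * T) = m * T) (hτ : sp τ + m * T = T)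
    {C A : Idl F} (hCJ : C ∈ Jgrp F m) (hAJ : A ∈ Jgrp F n') (hA1 : (1 : F) ∈ (A : FI F))
    (hC1 : (1 : F) ∈ (C : FI F)) {δ : F} (hδ : TotPos F δ) (hdet : (A : FI F) * C * sp δ = T) :
    ∃ v w : Fin 2 → F, Adm T m n g τ C A v w := by
  have hA := A.ne_zero
  have hC := C.ne_zero
  have hm0 := idl_ne (F := F) hm
  have en : (n : FI F) * T = n' * (m * T) := by rw [← hn, coeIdeal_mul]; ring
  have hn0 : (n : FI F) ≠ 0 := by
    rw [← hn, coeIdeal_mul]; exact mul_ne_zero (idl_ne hm) (idl_ne hn')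
  have hgI : g ∈ (m : FI F) * T := by
    rw [← sp_le]; conv_rhs => rw [← hg]
    exact le_self_add
  have hτI : τ ∈ T := by
    rw [← sp_le]; conv_rhs => rw [← hτ]
    exact le_self_add
  have hnm : (n : FI F) * T ≤ m * T := by rw [en]; exact mul_le_of_le_one (idl_le_one _)
  have up : ∀ {c : Ideal (𝓞 F)} {x : 𝓞 F}, x - 1 ∈ c → (x : F) - 1 ∈ (c : FI F) := by
    intro c x hx
    have := mem_idl (F := F).mpr hx
    rwa [c_sub, c_one] at this
  have hAi1 := inv_le_one_of hA1
  have hCi1 := inv_le_one_of hC1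
  obtain ⟨q, hq0, -, hq1, hqA⟩ := J_mem_pos hn' (inv_mem hAJ)
  rw [Units.val_inv_eq_inv_val] at hqA
  obtain ⟨q', hq0', -, hq1', hqC⟩ := J_mem_pos hm (inv_mem hCJ)
  rw [Units.val_inv_eq_inv_val] at hqC
  obtain ⟨c, hc0, hcne, -⟩ := exists_shift ((q : F) * g) (I := (A : FI F)⁻¹ * ((n : FI F) * T))
    (mul_ne_zero (inv_ne_zero hA) (mul_ne_zero hn0 hT))
  have hc : c ∈ (A : FI F)⁻¹ * (m * T) := by
    have := fadd (mul_le_mul_right hnm _ hc0) (mm hqA hgI le_rfl)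
    simpa using this
  have hcg : c - g ∈ n * T := by
    have : c - g = (c - q * g) + ((q : F) - 1) * g := by ring
    rw [this]
    refine fadd (mul_le_of_le_one hAi1 hc0) (mm (up hq1) hgI (le_of_eq en.symm))
  have hspc := sp_ne hcne
  have hCm : sp c * (A : FI F) * T⁻¹ ≤ m := by
    have := mul_le_mul_left (sp_le.mpr hc) ((A : FI F) * T⁻¹)
    rw [← mul_assoc] at this
    refine this.trans (le_of_eq ?_)
    field_simp
  obtain ⟨Ci, hCi⟩ := le_one_iff_exists_coeIdeal.mp (hCm.trans (idl_le_one m))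
  have hCine : Ci ≠ ⊥ := by
    rintro rfl
    rw [coeIdeal_bot] at hCi
    exact mul_ne_zero (mul_ne_zero hspc hA) (inv_ne_zero hT) hCi.symm
  have hI : (C : FI F)⁻¹ * T ≠ 0 := mul_ne_zero (inv_ne_zero hC) hT
  have hCiI : (Ci : FI F) * ((C : FI F)⁻¹ * T) = sp c * (A : FI F) * (C : FI F)⁻¹ := by
    rw [hCi]; field_simp
  have hCiT : (Ci : FI F) * ((C : FI F)⁻¹ * T) ≤ m * T := by
    rw [hCi]
    have h1 : (C : FI F)⁻¹ * T ≤ T := mul_le_of_le_one hCi1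
    exact (mul_le_mul_right h1 _).trans (mul_le_mul_left hCm _)
  obtain ⟨h, hhI, hh⟩ := exists_gen hI hCine
  have hy0 : (q' : F) * τ ∈ sp h + Ci * ((C : FI F)⁻¹ * T) := by
    rw [hh]; exact mm hqC hτI le_rfl
  obtain ⟨k1, hk1, f, hf, hkf⟩ := (mem_add _ _ _).mp hy0
  rw [← mul_one (sp h)] at hk1
  obtain ⟨e0, he0, rfl⟩ := mem_sp_mul.mp hk1
  obtain ⟨e, rfl⟩ := mem_one_int.mp he0
  have hhT : h ∈ T := mul_le_of_le_one hCi1 hhI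
  have hecop : Ideal.span {e} + m = ⊤ := by
    have h1 : sp (e : F) + (m : FI F) = 1 := by
      apply le_antisymm
      · exact sup_le (sp_le.mpr (mem_one_int.mpr ⟨e, rfl⟩)) (idl_le_one m)
      · refine le_cancel hT ?_
        rw [one_mul, add_mul]
        conv_lhs => rw [← hτ]
        refine sup_le ?_ le_add_self
        rw [sp_le]
        refine (mem_add _ _ _).mpr ⟨e * h, mm (mem_sp _) hhT le_rfl, f - ((q' : F) - 1) * τ, ?_, ?_⟩
        · exact fsub (hCiT hf) (mm (up hq1') hτI le_rfl)
        · linear_combination hkf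
    have h2 : ((Ideal.span {e} + m : Ideal (𝓞 F)) : FI F) = ((⊤ : Ideal (𝓞 F)) : FI F) := by
      rw [coeIdeal_top, ← h1]
      rw [show ((Ideal.span {e} + m : Ideal (𝓞 F)) : FI F) = (Ideal.span {e} : Ideal (𝓞 F)) + m from coeIdeal_sup _ _,
        coeIdeal_span_singleton]
    exact coeIdeal_inj.mp h2
  obtain ⟨s, hs, hes⟩ := lift_coprime hCine hecop
  set y := h * ((e + s : 𝓞 F) : F) with hy
  have hyI : y ∈ (C : FI F)⁻¹ * T := by
    rw [hy, mul_comm h]; exact fint _ hhI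
  have hyt : y - τ ∈ m * T := by
    have : y - τ = h * (s : F) - f + ((q' : F) - 1) * τ := by
      rw [hy, c_add]; linear_combination hkf
    rw [this]
    refine fadd (fsub (mm hhT (mem_idl.mpr hs) (le_of_eq (mul_comm _ _))) (hCiT hf))
      (mm (up hq1') hτI le_rfl)
  have hesF : sp ((e + s : 𝓞 F) : F) + (Ci : FI F) = 1 := by
    have h2 : ((Ideal.span {e + s} + Ci : Ideal (𝓞 F)) : FI F) = ((⊤ : Ideal (𝓞 F)) : FI F) := by
      rw [hes]
    rw [coeIdeal_top] at h2
    rw [← h2]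
    rw [show ((Ideal.span {e + s} + Ci : Ideal (𝓞 F)) : FI F) = (Ideal.span {e + s} : Ideal (𝓞 F)) + Ci from coeIdeal_sup _ _,
        coeIdeal_span_singleton]
  have hyc : sp y + Ci * ((C : FI F)⁻¹ * T) = (C : FI F)⁻¹ * T := by
    apply le_antisymm
    · exact sup_le (sp_le.mpr hyI) (mul_le_of_le_one (idl_le_one _))
    · conv_lhs => rw [← hh]
      refine sup_le ?_ le_add_self
      have e1 : sp h = sp y + Ci * sp h := by
        rw [hy, sp_mul]
        calc sp h = (sp ((e + s : 𝓞 F) : F) + (Ci : FI F)) * sp h := by rw [hesF, one_mul]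
          _ = _ := by ring
      rw [e1]
      exact add_le_add le_rfl (mul_le_mul_right (sp_le.mpr hhI) _)
  have hδm : δ ∈ sp y * (A : FI F)⁻¹ + sp c * (C : FI F)⁻¹ := by
    have e1 : sp y * (A : FI F)⁻¹ + sp c * (C : FI F)⁻¹ = sp δ := by
      have : sp y * (A : FI F)⁻¹ + sp c * (C : FI F)⁻¹ =
          (sp y + Ci * ((C : FI F)⁻¹ * T)) * (A : FI F)⁻¹ := by
        rw [hCiI]; field_simp
      rw [this, hyc]
      conv_lhs => rw [← hdet]
      field_simp
    rw [e1]; exact mem_sp δ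
  obtain ⟨k2, hk2, e2, he2, hd⟩ := (mem_add _ _ _).mp hδm
  obtain ⟨a, ha, rfl⟩ := mem_sp_mul.mp hk2
  obtain ⟨x', hx', rfl⟩ := mem_sp_mul.mp he2
  have hd' : a * y - c * (-x') = δ := by linear_combination hd
  refine ⟨![a, c], ![-x', y], ?_⟩
  constructor
  · exact ha
  · exact hc
  · exact fneg hx'
  · exact hyI
  · show (A : FI F) * C * sp (a * y - c * (-x')) = T
    rw [hd', hdet]
  · show TotPos F (a * y - c * (-x'))
    rw [hd']; exact hδ
  · exact hA1
  · exact hC1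
  · exact hcg
  · exact hyt

end helpers5

section helpers6
variable {F}

lemma diff_ne : diffIdl F ≠ 0 := idl_ne differentIdeal_ne_bot

lemma PrinPos_iff (u : Idl F) : u ∈ PrinPos F ↔ ∃ x : F, x ≠ 0 ∧ TotPos F x ∧ (u : FI F) = sp x := by
  constructor
  · intro hu
    induction hu using Subgroup.closure_induction with
    | mem u hu =>
      obtain ⟨x, hx, hux⟩ := hu
      refine ⟨x, ?_, hx, hux⟩
      rintro rfl
      apply u.ne_zero
      rw [hux]; simp
    | one => exact ⟨1, one_ne_zero, TotPos.one', by simp [sp]⟩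
    | mul u w _ _ hu hw =>
      obtain ⟨x, hx0, hx, hux⟩ := hu
      obtain ⟨y, hy0, hy, huy⟩ := hw
      exact ⟨x * y, mul_ne_zero hx0 hy0, hx.mul' hy, by rw [Units.val_mul, hux, huy, sp_mul]⟩
    | inv u _ hu =>
      obtain ⟨x, hx0, hx, hux⟩ := hu
      exact ⟨x⁻¹, inv_ne_zero hx0, hx.inv', by rw [Units.val_inv_eq_inv_val, hux, sp_inv]⟩
  · rintro ⟨x, -, hx, hux⟩
    exact Subgroup.subset_closure ⟨x, hx, hux⟩

/-- The relation defining `Q`. -/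
def DD (m n' : Ideal (𝓞 F)) (C A C' A' : Idl F) : Prop :=
  ∃ x z : F, RR n' x ∧ RR m z ∧ TotPos F (x * z) ∧
      (C' : FI F) = sp z * C ∧ (A' : FI F) = sp x * A

lemma mkQ_iff {m n' : Ideal (𝓞 F)} (h0 : m * n' ≠ ⊥) {C A C' A' : Idl F}
    (hC : C ∈ Jgrp F m) (hA : A ∈ Jgrp F n') (hC' : C' ∈ Jgrp F m) (hA' : A' ∈ Jgrp F n') :
    ((QuotientGroup.mk ((⟨C, hC⟩, ⟨A, hA⟩) : Jgrp F m × Jgrp F n') : Qgrp F m n') =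
      QuotientGroup.mk ((⟨C', hC'⟩, ⟨A', hA'⟩) : Jgrp F m × Jgrp F n')) ↔ DD m n' C A C' A' := by
  have key : ∀ (B B' : Idl F) (z : F), ((B⁻¹ * B' : Idl F) : FI F) = sp z ↔
      (B' : FI F) = sp z * B := by
    intro B B' z
    rw [Units.val_mul, Units.val_inv_eq_inv_val, inv_mul_eq_iff_eq_mul₀ B.ne_zero, mul_comm]
  refine QuotientGroup.eq.trans ((Dsub_iff h0 _).trans ?_)
  unfold DD
  refine exists_congr fun x => exists_congr fun z => ?_
  rw [← key, ← key]
  rfl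

lemma DD.symm {m n' : Ideal (𝓞 F)} {C A C' A' : Idl F} (h : DD m n' C A C' A') :
    DD m n' C' A' C A := by
  obtain ⟨x, z, hx, hz, hp, hC, hA⟩ := h
  have h1 := sp_ne hx.ne_zero
  have h2 := sp_ne hz.ne_zero
  refine ⟨x⁻¹, z⁻¹, hx.inv, hz.inv, ?_, ?_, ?_⟩
  · rw [← mul_inv]; exact hp.inv'
  · rw [hC, sp_inv, inv_mul_cancel_left₀ h2]
  · rw [hA, sp_inv, inv_mul_cancel_left₀ h1]

lemma DD.trans {m n' : Ideal (𝓞 F)} {C A C' A' C'' A'' : Idl F} (h : DD m n' C A C' A')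
    (h' : DD m n' C' A' C'' A'') : DD m n' C A C'' A'' := by
  obtain ⟨x, z, hx, hz, hp, hC, hA⟩ := h
  obtain ⟨x', z', hx', hz', hp', hC', hA'⟩ := h'
  refine ⟨x' * x, z' * z, hx'.mul hx, hz'.mul hz, ?_, ?_, ?_⟩
  · have := hp'.mul' hp
    rwa [mul_mul_mul_comm] at this
  · rw [hC', hC, sp_mul, mul_assoc]
  · rw [hA', hA, sp_mul, mul_assoc]

lemma one_mem_GT (T : FI F) (n : Ideal (𝓞 F)) : (1 : Matrix (Fin 2) (Fin 2) F) ∈ GT T n := by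
  refine ⟨⟨1, by simp⟩, ⟨1, by simp⟩, ?_, ?_, ⟨1, by simp⟩, ?_, ?_⟩
  · rw [Matrix.one_apply_ne (by decide)]; exact fzero
  · rw [Matrix.one_apply_ne (by decide)]; exact fzero
  · rw [Matrix.det_one]; exact TotPos.one'
  · rw [Matrix.one_apply_eq, sub_self]; exact fzero

lemma mA_smul {tl : FI F} (hT : tl * diffIdl F ≠ 0) {v : Fin 2 → F} (hv : v ≠ 0)
    (n : Ideal (𝓞 F)) {s : F} (hs : s ≠ 0) : mA F tl n (s • v) = mA F tl n v := by
  refine mA_inv hT hv (smul_ne_zero hs hv) n (γ := 1) (one_mem_GT _ n) (inv_ne_zero hs) ?_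
  rw [Matrix.one_mulVec, smul_smul, inv_mul_cancel₀ hs, one_smul]

/-- The relation defining the set of cusps. -/
abbrev rel (tl : FI F) (n : Ideal (𝓞 F)) : Vnz F → Vnz F → Prop :=
  fun v w : Vnz F => ∃ γ ∈ Gamma F tl n, ∃ s : Fˣ, Matrix.mulVec γ v.1 = (s : F) • w.1

lemma eqv_DD {tl : FI F} (hT : tl * diffIdl F ≠ 0) {m n n' : Ideal (𝓞 F)} (hm : m ≠ ⊥)
    (hn' : n' ≠ ⊥) (hn : m * n' = n) {g τ : F}
    (hg : sp g + n' * (m * (tl * diffIdl F)) = m * (tl * diffIdl F))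
    (hτ : sp τ + m * (tl * diffIdl F) = tl * diffIdl F)
    {v v' : Vnz F} (h : Relation.EqvGen (rel tl n) v v') :
    mA F tl n v.1 = mA F tl n v'.1 ∧ (mA F tl n v.1 = m →
      ∀ (k k' : F) (C A C' A' : Idl F) (w w' : Fin 2 → F), k ≠ 0 → k' ≠ 0 →
      Adm (tl * diffIdl F) m n g τ C A (k • v.1) w →
      Adm (tl * diffIdl F) m n g τ C' A' (k' • v'.1) w' → DD m n' C A C' A') := by
  have step : ∀ (v v' : Vnz F) (γ : Matrix (Fin 2) (Fin 2) F), γ ∈ GT (tl * diffIdl F) n →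
      ∀ (s : F), s ≠ 0 → Matrix.mulVec γ v.1 = s • v'.1 →
      ∀ (k k' : F) (C A C' A' : Idl F) (w w' : Fin 2 → F), k ≠ 0 → k' ≠ 0 →
      Adm (tl * diffIdl F) m n g τ C A (k • v.1) w →
      Adm (tl * diffIdl F) m n g τ C' A' (k' • v'.1) w' → DD m n' C A C' A' := by
    intro v v' γ hγ s hs hv k k' C A C' A' w w' hk hk' h h'
    refine adm_forward hT hm hn' hn hg hτ h h' hγ (s := k * s * k'⁻¹)
      (mul_ne_zero (mul_ne_zero hk hs) (inv_ne_zero hk')) ?_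
    rw [Matrix.mulVec_smul, hv, smul_smul, smul_smul, inv_mul_cancel_right₀ hk']
  induction h with
  | rel v v' h =>
    obtain ⟨γ, hγ, s, hs⟩ := h
    exact ⟨(mA_inv hT v.2 v'.2 n hγ s.ne_zero hs).symm,
      fun _ => step v v' γ hγ s s.ne_zero hs⟩
  | refl v =>
    refine ⟨rfl, fun _ => step v v 1 (one_mem_GT _ n) 1 one_ne_zero ?_⟩
    rw [Matrix.one_mulVec, one_smul]
  | symm v v' _ ih =>
    refine ⟨ih.1.symm, fun hm' k k' C A C' A' w w' hk hk' h h' => ?_⟩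
    exact (ih.2 (ih.1.trans hm') k' k C' A' C A w' w hk' hk h' h).symm
  | trans v v' v'' _ _ ih ih' =>
    refine ⟨ih.1.trans ih'.1, fun hm' k k' C A C' A' w w' hk hk' h h' => ?_⟩
    have hm'' := ih.1.symm.trans hm'
    obtain ⟨l, hl, C1, A1, w1, h1⟩ := exists_adm hT hm hn' hn hg hτ v'.2
      ((mA_eq_iff hT v'.2 n m).mp hm'')
    exact (ih.2 hm' k l C A C1 A1 w w1 hk hl h h1).trans
      (ih'.2 hm'' l k' C1 A1 C' A' w1 w' hl hk' h1 h')

lemma card_of {X α β : Type*} (f : X → α) (g : X → β) (hf : Function.Surjective f)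
    (hg : Function.Surjective g) (h : ∀ x y, f x = f y ↔ g x = g y) :
    Nat.card α = Nat.card β := by
  refine Nat.card_eq_of_bijective (fun a => g (Function.surjInv hf a)) ⟨?_, ?_⟩
  · intro a b hab
    have := (h _ _).mpr hab
    rwa [Function.surjInv_eq hf, Function.surjInv_eq hf] at this
  · intro b
    obtain ⟨x, rfl⟩ := hg b
    exact ⟨f x, (h _ _).mp (Function.surjInv_eq hf _)⟩

/-- Adapted data over all components. -/
structure XD (t : ClPlus F → Idl F) (m n : Ideal (𝓞 F)) (g τ : ClPlus F → F) where
  l : ClPlus F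
  C : Idl F
  A : Idl F
  v : Fin 2 → F
  w : Fin 2 → F
  adm : Adm ((t l : FI F) * diffIdl F) m n (g l) (τ l) C A v w

lemma T_ne (u : Idl F) : (u : FI F) * diffIdl F ≠ 0 := mul_ne_zero u.ne_zero diff_ne

lemma Adm.mA_eq {tl : FI F} (hT : tl * diffIdl F ≠ 0) {m n n' : Ideal (𝓞 F)} (hn : m * n' = n)
    {g τ : F} (hg : sp g + n' * (m * (tl * diffIdl F)) = m * (tl * diffIdl F)) {C A : Idl F}
    {v w : Fin 2 → F} (h : Adm (tl * diffIdl F) m n g τ C A v w) : mA F tl n v = m := by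
  rw [mA_eq_iff hT (h.v_ne hT), h.b hT, inv_inv]
  exact h.K hT hn hg

lemma card_stratum {n : Ideal (𝓞 F)} (h0 : n ≠ ⊥)
    {t : ClPlus F → Idl F} (ht : ∀ l, QuotientGroup.mk (t l) = l) {m n' : Ideal (𝓞 F)}
    (hn : m * n' = n) :
    Nat.card {x : Cusps F t n // x ∈ Stratum F t n m} = Nat.card (Qgrp F m n') := by
  have hmn : m * n' ≠ ⊥ := hn ▸ h0
  have hm : m ≠ ⊥ := by rintro rfl; simp at hmn
  have hn' : n' ≠ ⊥ := by rintro rfl; simp at hmn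
  have hT : ∀ l, (t l : FI F) * diffIdl F ≠ 0 := fun l => T_ne (t l)
  choose g _ hg using fun l => exists_gen (I := (m : FI F) * ((t l : FI F) * diffIdl F))
    (mul_ne_zero (idl_ne hm) (hT l)) hn'
  choose τ _ hτ using fun l => exists_gen (I := (t l : FI F) * diffIdl F) (hT l) hm
  let f : XD t m n g τ → {x : Cusps F t n // x ∈ Stratum F t n m} := fun X =>
    ⟨⟨X.l, Quot.mk _ ⟨X.v, X.adm.v_ne (hT _)⟩⟩, ⟨X.v, X.adm.v_ne (hT _)⟩, rfl,
      X.adm.mA_eq (hT _) hn (hg _)⟩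
  let q : XD t m n g τ → Qgrp F m n' := fun X =>
    QuotientGroup.mk ((⟨X.C, X.adm.JC (hT _) (hτ _)⟩, ⟨X.A, X.adm.JA (hT _) hm hn (hg _)⟩) :
      Jgrp F m × Jgrp F n')
  refine card_of f q ?_ ?_ ?_
  · rintro ⟨⟨l, c⟩, v, hvc, hv⟩
    obtain ⟨k, hk, C, A, w, h⟩ := exists_adm (hT l) hm hn' hn (hg l) (hτ l) v.2
      ((mA_eq_iff (hT l) v.2 n m).mp hv)
    refine ⟨⟨l, C, A, k • v.1, w, h⟩, Subtype.ext ?_⟩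
    refine congrArg (Sigma.mk l) ?_
    refine Eq.trans ?_ hvc
    refine Quot.sound ⟨1, one_mem_GT _ n, Units.mk0 k hk, ?_⟩
    rw [Matrix.one_mulVec]; rfl
  · intro b
    obtain ⟨⟨⟨C0, hC0⟩, ⟨A0, hA0⟩⟩, rfl⟩ := QuotientGroup.mk_surjective b
    obtain ⟨a, ha0, hap, ha1, haC⟩ := J_mem_pos hm hC0
    obtain ⟨b, hb0, hbp, hb1, hbA⟩ := J_mem_pos hn' hA0
    let C : Idl F := (spu (a : F) (int_ne ha0))⁻¹ * C0
    let A : Idl F := (spu (b : F) (int_ne hb0))⁻¹ * A0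
    have hCJ : C ∈ Jgrp F m := mul_mem (inv_mem (J_mem_int ha0 ha1)) hC0
    have hAJ : A ∈ Jgrp F n' := mul_mem (inv_mem (J_mem_int hb0 hb1)) hA0
    have hCc : (C : FI F) = sp (a : F)⁻¹ * C0 := by
      show (((spu (a : F) (int_ne ha0))⁻¹ * C0 : Idl F) : FI F) = _
      rw [Units.val_mul, Units.val_inv_eq_inv_val, spu_coe, sp_inv]
    have hAc : (A : FI F) = sp (b : F)⁻¹ * A0 := by
      show (((spu (b : F) (int_ne hb0))⁻¹ * A0 : Idl F) : FI F) = _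
      rw [Units.val_mul, Units.val_inv_eq_inv_val, spu_coe, sp_inv]
    have hC1 : (1 : F) ∈ (C : FI F) := by
      rw [hCc, ← inv_mul_cancel₀ (int_ne ha0)]
      exact mm (mem_sp _) haC le_rfl
    have hA1 : (1 : F) ∈ (A : FI F) := by
      rw [hAc, ← inv_mul_cancel₀ (int_ne hb0)]
      exact mm (mem_sp _) hbA le_rfl
    have hDD : DD m n' C0 A0 C A := by
      refine ⟨(b : F)⁻¹, (a : F)⁻¹, (RR.of_int hb0 hb1).inv, (RR.of_int ha0 ha1).inv,
        hbp.inv'.mul' hap.inv', hCc, hAc⟩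
    let D : Idl F := Units.mk0 (diffIdl F) diff_ne
    let l : ClPlus F := QuotientGroup.mk (A * C * D⁻¹)
    have hl : (QuotientGroup.mk (A * C * D⁻¹) : Idl F ⧸ PrinPos F) = QuotientGroup.mk (t l) :=
      (ht l).symm
    obtain ⟨δ, hδ0, hδ, hδe⟩ := (PrinPos_iff _).mp (QuotientGroup.eq.mp hl)
    have hdet : (A : FI F) * C * sp δ = (t l : FI F) * diffIdl F := by
      have hD : (D : FI F) = diffIdl F := rfl
      rw [← hδe, ← hD, ← Units.val_mul, ← Units.val_mul, ← Units.val_mul]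
      congr 1
      rw [mul_inv, mul_inv, inv_inv]
      have : A * C * (A⁻¹ * C⁻¹ * D * t l) = (A * A⁻¹) * (C * C⁻¹) * (t l * D) := by ac_rfl
      rw [this, mul_inv_cancel, mul_inv_cancel, one_mul, one_mul]
    obtain ⟨v, w, h⟩ := exists_adm_of (hT l) hm hn' hn (hg l) (hτ l) hCJ hAJ hA1 hC1 hδ hdet
    refine ⟨⟨l, C, A, v, w, h⟩, ?_⟩
    exact (mkQ_iff hmn _ _ _ _).mpr hDD.symm
  · rintro ⟨l, C, A, v, w, h⟩ ⟨l', C', A', v', w', h'⟩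
    refine Iff.trans ?_ (mkQ_iff hmn _ _ _ _).symm
    constructor
    · intro hf
      have hf' := Subtype.ext_iff.mp hf
      have hl : l = l' := congrArg Sigma.fst hf'
      subst hl
      have hq := eq_of_heq (Sigma.mk.inj hf').2
      have he := Quot.eqvGen_exact hq
      refine (eqv_DD (hT l) hm hn' hn (hg l) (hτ l) he).2 (h.mA_eq (hT l) hn (hg l)) 1 1
        C A C' A' w w' one_ne_zero one_ne_zero ?_ ?_
      · rw [one_smul]; exact h
      · rw [one_smul]; exact h'
    · rintro ⟨x, z, hx, hz, hp, hC, hA⟩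
      dsimp only at hC hA
      have hl : l = l' := by
        rw [← ht l, ← ht l']
        refine QuotientGroup.eq.mpr ((PrinPos_iff _).mpr ?_)
        have hδ := h.delta_ne (hT l)
        have hδ' := h'.delta_ne (hT l')
        have hd := h.det
        have hd' := h'.det
        have hpos := h.pos
        have hpos' := h'.pos
        set δ := v 0 * w 1 - v 1 * w 0
        set δ' := v' 0 * w' 1 - v' 1 * w' 0
        refine ⟨x * z * δ' * δ⁻¹, mul_ne_zero (mul_ne_zero (mul_ne_zero hx.ne_zero hz.ne_zero) hδ')
          (inv_ne_zero hδ), (hp.mul' hpos').mul' hpos.inv', ?_⟩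
        rw [Units.val_mul, Units.val_inv_eq_inv_val, inv_mul_eq_iff_eq_mul₀ (t l).ne_zero]
        apply mul_right_cancel₀ (diff_ne (F := F))
        rw [← hd', hA, hC, mul_right_comm (t l : FI F), ← hd, sp_mul, sp_mul, sp_mul, sp_inv]
        have := sp_ne hδ
        field_simp
      subst hl
      obtain ⟨γ, hγ, hv⟩ := adm_backward (hT l) hm hn' hn (hg l) (hτ l) h h' hx hz hp hC hA
      refine Subtype.ext (congrArg (Sigma.mk l) ?_)
      exact Quot.sound ⟨γ, hγ, Units.mk0 x hx.ne_zero, hv⟩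

lemma unique_stratum {n : Ideal (𝓞 F)} (t : ClPlus F → Idl F) (x : Cusps F t n) :
    ∃! m : Ideal (𝓞 F), m ∣ n ∧ x ∈ Stratum F t n m := by
  obtain ⟨l, c⟩ := x
  obtain ⟨v, rfl⟩ := Quot.exists_rep c
  refine ⟨mA F (t l) n v.1, ⟨Ideal.dvd_iff_le.mpr le_sup_right, v, rfl, rfl⟩, ?_⟩
  rintro m' ⟨-, v', hv', rfl⟩
  let mQ : CuspComp F ((t l : Idl F) : FI F) n → Ideal (𝓞 F) :=
    Quot.lift (fun v => mA F (t l) n v.1) (by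
      rintro v w ⟨γ, hγ, s, hs⟩
      exact (mA_inv (T_ne (t l)) v.2 w.2 n hγ s.ne_zero hs).symm)
  exact congrArg mQ hv'

end helpers6

/-- The set of cusps is stratified as `cusps(n) = ⊔_{m ∣ n} 𝔔_{m,n}`, with each
stratum `𝔔_{m,n}` of cardinality `#Q_{m,n}`; in particular
`#cusps(n) = ∑_{m ∣ n} #Q_{m,n}`. -/
theorem stmt13 (n : Ideal (𝓞 F)) (hn : n ≠ ⊥)
    (t : ClPlus F → Idl F) (ht : ∀ l, QuotientGroup.mk (t l) = l) :
    (∀ x : Cusps F t n, ∃! m : Ideal (𝓞 F), m ∣ n ∧ x ∈ Stratum F t n m) ∧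
    (∀ m n' : Ideal (𝓞 F), m * n' = n →
      Nat.card {x : Cusps F t n // x ∈ Stratum F t n m} = Nat.card (Qgrp F m n')) := by
  exact ⟨fun x => unique_stratum t x, fun m n' hmn => card_stratum hn ht hmn⟩

end
end
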